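/- arXiv:2205.01792 — 2 statements merged into one kernel-verified Lean document; each statement's English description precedes it below -/
import Mathlib

section
/- Let Ĝ be the group generated by the twelve transformations {a_0, a_1, a_2, b_0, b_1, b_2, c_0, c_1, c_2, d_0, d_1, d_2} of the golden mean shift X (the fragmentation of the golden mean dihedral group). Then the growth of Ĝ satisfies γ_Ĝ(R) ≼ exp(R^{0.9181}). -/
noncomputable section
open scoped Classical

namespace GoldenMean

/-- Infinite binary sequences (`false` = 0, `true` = 1). -/
abbrev Seq := ℕ → Bool

/-- The golden mean shift: sequences over `{0,1}` with no two consecutive `1`'s. -/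
def goldenX : Set Seq := {w | ∀ n : ℕ, ¬(w n = true ∧ w (n + 1) = true)}

/-- Flip the letter at position `k`. -/
def flipAt (k : ℕ) (w : Seq) : Seq := fun n => if n = k then !(w n) else w n

/-- Shift a sequence by `k` letters. -/
def shiftBy (k : ℕ) (w : Seq) : Seq := fun n => w (n + k)

/-- The `j`-th block of three letters of `w` equals `010`. -/
def block010 (w : Seq) (j : ℕ) : Prop :=
  w (3 * j) = false ∧ w (3 * j + 1) = true ∧ w (3 * j + 2) = false

/-- The index of the first block of three letters of `w` different from `010`. -/
def firstNon010 (w : Seq) : ℕ := sInf {j | ¬ block010 w j}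

/-- The generator `a₀`:
`(00w)·a₀ = 10w`, `(10w)·a₀ = 00w`, `(010w)·a₀ = 010w`. -/
def gmA0 (w : Seq) : Seq :=
  if block010 w 0 then w else flipAt 0 w

/-- The common pattern of the generators `b₀`, `c₀`, `d₀`: if `w = (010)^k v` with
`v` not beginning with `010`, the first letter of `v` (i.e. the letter in position
`3k`) is flipped iff `k % 3 ≠ r`; sequences of the form `(010)^∞` are fixed.
For `r = 2` this is exactly the transformation `b₀` defined recursively by
`(00w)·b₀ = 10w`, `(10w)·b₀ = 00w`, `(010w)·b₀ = 010(w·c₀)` (and analogously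
`r = 1` for `c₀`, `r = 0` for `d₀`). -/
def gmStep (r : ℕ) (w : Seq) : Seq :=
  if ∃ j, ¬ block010 w j then
    (if (firstNon010 w) % 3 ≠ r then flipAt (3 * firstNon010 w) w else w)
  else w

/-- `b₀`: `(00w)·b₀ = 10w`, `(10w)·b₀ = 00w`, `(010w)·b₀ = 010(w·c₀)`. -/
def gmB0 : Seq → Seq := gmStep 2
/-- `c₀`: `(00w)·c₀ = 10w`, `(10w)·c₀ = 00w`, `(010w)·c₀ = 010(w·d₀)`. -/
def gmC0 : Seq → Seq := gmStep 1
/-- `d₀`: `(00w)·d₀ = 00w`, `(10w)·d₀ = 10w`, `(010w)·d₀ = 010(w·b₀)`. -/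
def gmD0 : Seq → Seq := gmStep 0

/-- `x₁` from `x₀`: `(0w)·x₁ = 0(w·x₀)`, `(10w)·x₁ = 10w`. -/
def lift1 (f : Seq → Seq) (w : Seq) : Seq :=
  if w 0 = false then (fun n => if n = 0 then w 0 else f (shiftBy 1 w) (n - 1)) else w

/-- `x₂` from `x₀`: `(0w)·x₂ = 0w`, `(10w)·x₂ = 10(w·x₀)`. -/
def lift2 (f : Seq → Seq) (w : Seq) : Seq :=
  if w 0 = false then w else (fun n => if n < 2 then w n else f (shiftBy 2 w) (n - 2))

/-- The twelve generators `{aᵢ, bᵢ, cᵢ, dᵢ : i = 0, 1, 2}` of the fragmentation of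
the golden mean dihedral group. -/
def gmGens : Set (Seq → Seq) :=
  {gmA0, lift1 gmA0, lift2 gmA0,
   gmB0, lift1 gmB0, lift2 gmB0,
   gmC0, lift1 gmC0, lift2 gmC0,
   gmD0, lift1 gmD0, lift2 gmD0}

/-- The transformation given by a word in the generators. -/
def comp (l : List (Seq → Seq)) : Seq → Seq := l.foldr (· ∘ ·) id

/-- `γ_Ĝ(R)`: the number of distinct bijections of the golden mean shift `X`
representable as products of at most `R` generators (all generators are
involutions, so these are exactly the elements of word length at most `R`). -/
def gmGrowth (R : ℕ) : ℕ :=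
  Nat.card ((fun f : Seq → Seq => goldenX.restrict f) ''
    {f | ∃ l : List (Seq → Seq),
      (∀ s ∈ l, s ∈ gmGens) ∧ l.length ≤ R ∧ comp l = f})

/-- The prefix of length `m` of `w` is the left-infinite word `…010010` cut to length `m`. -/
def HasStrongPrefix (m : ℕ) (w : Seq) : Prop := ∀ j < m, w j = decide ((m - j) % 3 = 2)

/-- Position `m` of `w` is the position flipped by the generators of type `m % 3`. -/
def Switchable (m : ℕ) (w : Seq) : Prop := HasStrongPrefix m w ∧ w (m + 1) = false

/-- The word `…010010` of length `n`, followed by zeros. -/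
def strong (n : ℕ) : Seq := fun j => decide (j < n ∧ (n - j) % 3 = 2)

/-- The first `n` letters of `v` followed by the letters of `y` from position `n` on. -/
def splice (n : ℕ) (v y : Seq) : Seq := fun j => if j < n then v j else y j

/-- The points of the golden mean shift that vanish from position `n` on. -/
def tile (n : ℕ) : Set Seq := {v | v ∈ goldenX ∧ ∀ j, n ≤ j → v j = false}

/-- Flip the switchable position `m ≡ i` modulo `3`, if it exists and `o m = 1`. -/
def toggle (i : ℕ) (o : ℕ → ZMod 2) (w : Seq) : Seq :=
  if h : ∃ m, m % 3 = i ∧ Switchable m w then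
    (if o h.choose = 1 then flipAt h.choose w else w)
  else w

lemma HasStrongPrefix.of_le {m k : ℕ} {w : Seq} (h : HasStrongPrefix m w) (hk : k ≤ m)
    (hm : k % 3 = m % 3) : HasStrongPrefix k w := by
  intro j hj
  rw [h j (by omega)]
  congr 1
  apply propext
  omega

lemma Switchable.unique {m k : ℕ} {w : Seq} (h : Switchable m w) (hk : Switchable k w)
    (hm : m % 3 = k % 3) : m = k := by
  by_contra hne
  rcases Nat.lt_or_gt_of_ne hne with hlt | hlt
  · have := hk.1 (m + 1) (by omega)
    rw [h.2] at this
    simp at this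
    omega
  · have := h.1 (k + 1) (by omega)
    rw [hk.2] at this
    simp at this
    omega

lemma Switchable.flipAt {m : ℕ} {w : Seq} (h : Switchable m w) : Switchable m (flipAt m w) := by
  refine ⟨fun j hj => ?_, ?_⟩
  · simp only [GoldenMean.flipAt, if_neg (show j ≠ m by omega)]
    exact h.1 j hj
  · simpa [GoldenMean.flipAt] using h.2

lemma flipAt_flipAt (m : ℕ) (w : Seq) : flipAt m (flipAt m w) = w := by
  funext j
  by_cases hj : j = m <;> simp [flipAt, hj]

lemma toggle_of_switchable {i m : ℕ} (o : ℕ → ZMod 2) {w : Seq} (hi : m % 3 = i)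
    (h : Switchable m w) : toggle i o w = if o m = 1 then flipAt m w else w := by
  have hex : ∃ m, m % 3 = i ∧ Switchable m w := ⟨m, hi, h⟩
  have hm : hex.choose = m :=
    hex.choose_spec.2.unique h (hex.choose_spec.1.trans hi.symm)
  simp only [toggle, dif_pos hex, hm]

lemma toggle_of_not {i : ℕ} (o : ℕ → ZMod 2) {w : Seq}
    (h : ∀ m, m % 3 = i → ¬ Switchable m w) : toggle i o w = w := by
  have hex : ¬ ∃ m, m % 3 = i ∧ Switchable m w := fun ⟨m, hm, hs⟩ => h m hm hs
  simp only [toggle, dif_neg hex]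

lemma toggle_zero {i m : ℕ} {o : ℕ → ZMod 2} {w : Seq} (hi : m % 3 = i)
    (h : Switchable m w) (ho : o m = 0) : toggle i o w = w := by
  rw [toggle_of_switchable o hi h, ho, if_neg (by decide)]

lemma toggle_toggle (i : ℕ) (o o' : ℕ → ZMod 2) (w : Seq) :
    toggle i o (toggle i o' w) = toggle i (o + o') w := by
  by_cases hex : ∃ m, m % 3 = i ∧ Switchable m w
  · obtain ⟨m, hi, h⟩ := hex
    rw [toggle_of_switchable o' hi h, toggle_of_switchable (o + o') hi h]
    have key : ∀ a b : ZMod 2, (a = 0 ∨ a = 1) ∧ (b = 0 ∨ b = 1) := by decide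
    obtain ⟨ha, hb⟩ := key (o m) (o' m)
    rcases ha with ha | ha <;> rcases hb with hb | hb <;>
      simp [ha, hb, toggle_of_switchable o hi h, toggle_of_switchable o hi h.flipAt,
        flipAt_flipAt, show (1 + 1 : ZMod 2) = 0 from rfl]
  · have hex : ∀ m, m % 3 = i → ¬ Switchable m w := fun m hm hs => hex ⟨m, hm, hs⟩
    rw [toggle_of_not o' hex, toggle_of_not o hex, toggle_of_not _ hex]

lemma toggle_zero_fun (i : ℕ) (w : Seq) : toggle i 0 w = w := by
  by_cases hex : ∃ m, m % 3 = i ∧ Switchable m w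
  · obtain ⟨m, hi, h⟩ := hex
    exact toggle_zero hi h rfl
  · exact toggle_of_not _ fun m hm hs => hex ⟨m, hm, hs⟩

lemma toggle_involutive (i : ℕ) (o : ℕ → ZMod 2) (w : Seq) :
    toggle i o (toggle i o w) = w := by
  rw [toggle_toggle, CharTwo.add_self_eq_zero, toggle_zero_fun]

lemma toggle_cases (i : ℕ) (o : ℕ → ZMod 2) (w : Seq) :
    toggle i o w = w ∨ ∃ m, m % 3 = i ∧ Switchable m w ∧ o m = 1 ∧
      toggle i o w = flipAt m w := by
  by_cases hex : ∃ m, m % 3 = i ∧ Switchable m w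
  · obtain ⟨m, hi, h⟩ := hex
    by_cases ho : o m = 1
    · exact Or.inr ⟨m, hi, h, ho, by rw [toggle_of_switchable o hi h, if_pos ho]⟩
    · exact Or.inl (by rw [toggle_of_switchable o hi h, if_neg ho])
  · exact Or.inl (toggle_of_not _ fun m hm hs => hex ⟨m, hm, hs⟩)

lemma flipAt_mem {m : ℕ} {w : Seq} (hw : w ∈ goldenX) (h : Switchable m w) :
    flipAt m w ∈ goldenX := by
  intro n hn
  have hwn := hw n
  have h2 := h.2
  simp only [flipAt] at hn
  by_cases h1 : n = m
  · subst h1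
    simp [h2] at hn
  · by_cases h3 : n + 1 = m
    · have := h.1 n (by omega)
      rw [if_neg h1, this] at hn
      have := hn.1
      simp at this
      omega
    · rw [if_neg h1, if_neg h3] at hn
      exact hwn hn

lemma toggle_mem (i : ℕ) (o : ℕ → ZMod 2) {w : Seq} (hw : w ∈ goldenX) :
    toggle i o w ∈ goldenX := by
  rcases toggle_cases i o w with h | ⟨m, -, hs, -, h⟩
  · rwa [h]
  · rw [h]
    exact flipAt_mem hw hs

lemma toggle_mem_tile {i n : ℕ} {o : ℕ → ZMod 2} {w : Seq} (hw : w ∈ tile n)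
    (ho : ∀ m, n ≤ m → o m = 0) : toggle i o w ∈ tile n := by
  refine ⟨toggle_mem i o hw.1, fun j hj => ?_⟩
  rcases toggle_cases i o w with h | ⟨m, -, -, h1, h⟩
  · rw [h]
    exact hw.2 j hj
  · have : m < n := by
      by_contra hm
      rw [ho m (by omega)] at h1
      exact absurd h1 (by decide)
    rw [h, flipAt, if_neg (by omega)]
    exact hw.2 j hj

lemma toggle_hasStrongPrefix {i n : ℕ} (o : ℕ → ZMod 2) {w : Seq} (hi : n % 3 = i)
    (hw : HasStrongPrefix n w) : HasStrongPrefix n (toggle i o w) := by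
  rcases toggle_cases i o w with h | ⟨m, hm, hs, -, h⟩
  · rwa [h]
  · have hnm : n ≤ m := by
      by_contra hlt
      have := hw (m + 1) (by omega)
      rw [hs.2] at this
      simp at this
      omega
    intro j hj
    rw [h, flipAt, if_neg (by omega)]
    exact hw j hj

lemma strong_hasStrongPrefix (n : ℕ) : HasStrongPrefix n (strong n) := by
  intro j hj
  simp [strong, hj]

lemma strong_switchable (n : ℕ) : Switchable n (strong n) :=
  ⟨strong_hasStrongPrefix n, by simp [strong]⟩

lemma strong_mem (n : ℕ) : strong n ∈ goldenX := by
  intro j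
  simp [strong]
  omega

lemma strong_mem_tile {n k : ℕ} (h : n ≤ k + 1) : strong n ∈ tile k := by
  refine ⟨strong_mem n, fun j hj => ?_⟩
  simp [strong]
  omega

lemma splice_self_of_hasStrongPrefix {n : ℕ} {y : Seq} (h : HasStrongPrefix n y) :
    splice n (strong n) y = y := by
  funext j
  by_cases hj : j < n
  · simp [splice, strong, hj, h j hj]
  · simp [splice, hj]

lemma eq_strong {n k : ℕ} {v : Seq} (hv : v ∈ tile k) (h : HasStrongPrefix n v)
    (hn : n = k ∨ n = k + 1) : v = strong n := by
  funext j
  by_cases hj : j < n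
  · simp [strong, hj, h j hj]
  · rw [hv.2 j (by omega)]
    simp [strong, hj]

/-- Away from the two ends of a tile, a letter acts on a point of the tile followed by an
arbitrary tail through its truncation; at the end `strong (n + 1)` it acts on the tail. -/
lemma toggle_splice {n i : ℕ} {o o' : ℕ → ZMod 2} {v y : Seq} (hv : v ∈ tile n)
    (hy : HasStrongPrefix (n + 1) y) (ho : ∀ m < n, o' m = o m) (ho' : ∀ m, n ≤ m → o' m = 0)
    (hne : ¬ (i = n % 3 ∧ v = strong n)) (hi : i < 3) :
    toggle i o (splice (n + 1) v y) =
      splice (n + 1) (toggle i o' v)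
        (if i = (n + 1) % 3 ∧ v = strong (n + 1) then toggle i o y else y) := by
  by_cases hS : i = (n + 1) % 3 ∧ v = strong (n + 1)
  · rw [if_pos hS]
    obtain ⟨hi', rfl⟩ := hS
    rw [toggle_zero hi'.symm (strong_switchable _) (ho' _ (by omega)),
      splice_self_of_hasStrongPrefix hy,
      splice_self_of_hasStrongPrefix (toggle_hasStrongPrefix o hi'.symm hy)]
  · rw [if_neg hS]
    have hvn : v n = false := hv.2 n le_rfl
    have no_large : ∀ w : Seq, (∀ j ≤ n, w j = v j) → ∀ m, m % 3 = i → n ≤ m →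
        ¬ HasStrongPrefix m w := by
      intro w hw m hm hnm hp
      have trans_prefix : ∀ k, k ≤ n + 1 → HasStrongPrefix k w → HasStrongPrefix k v :=
        fun k hk h j hj => by rw [← hw j (by omega)]; exact h j hj
      have hcases : m % 3 = n % 3 ∨ m % 3 = (n + 1) % 3 ∨ m % 3 = (n + 2) % 3 := by omega
      rcases hcases with h | h | h
      · exact hne ⟨by omega, eq_strong hv
          (trans_prefix n (by omega) (hp.of_le hnm h.symm)) (Or.inl rfl)⟩
      · exact hS ⟨by omega, eq_strong hv
          (trans_prefix (n + 1) le_rfl (hp.of_le (by omega) h.symm)) (Or.inr rfl)⟩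
      · have := hp n (by omega)
        rw [hw n le_rfl, hvn] at this
        simp at this
        omega
    have hagree : ∀ j ≤ n, splice (n + 1) v y j = v j := fun j hj => by
      simp [splice, show j < n + 1 by omega]
    have hiff : ∀ m < n, (Switchable m (splice (n + 1) v y) ↔ Switchable m v) := by
      intro m hm
      unfold Switchable HasStrongPrefix
      rw [hagree (m + 1) (by omega)]
      refine and_congr_left fun _ => forall₂_congr fun j hj => ?_
      rw [hagree j (by omega)]
    by_cases hex : ∃ m, m % 3 = i ∧ Switchable m v
    · obtain ⟨m, hm, hs⟩ := hex
      have hmn : m < n := by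
        by_contra hc
        exact no_large v (fun _ _ => rfl) m hm (by omega) hs.1
      rw [toggle_of_switchable _ hm hs, toggle_of_switchable _ hm ((hiff m hmn).2 hs),
        ho m hmn]
      split_ifs
      · funext j
        by_cases hj : j = m
        · subst hj
          simp [flipAt, splice, show j < n + 1 by omega]
        · simp [flipAt, splice, hj]
      · rfl
    · rw [toggle_of_not _ fun m hm hs => hex ⟨m, hm, hs⟩, toggle_of_not]
      intro m hm hs
      by_cases hmn : m < n
      · exact hex ⟨m, hm, (hiff m hmn).1 hs⟩
      · exact no_large _ hagree m hm (by omega) hs.1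

/-- A letter flips, among the positions congruent to `ty` modulo `3`, the switchable position `m`
if `op m = 1`; for `m ≥ 3` this depends only on `m / 3` modulo `3`, through `chi`. -/
structure Letter where
  ty : ℕ
  ty_lt : ty < 3
  op : ℕ → ZMod 2
  chi : Fin 3 → ZMod 2
  op_eq : ∀ m, 3 ≤ m → op m = chi (Fin.ofNat 3 (m / 3))
  chi_sum : chi 0 + chi 1 + chi 2 = 0

/-- The positions flipped by a product of letters of one type, away from the first letters. -/
def deep (x : Fin 3 → ZMod 2) : ℕ → ZMod 2 := fun m => x (Fin.ofNat 3 (m / 3))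

/-- The indicator function of `{m | m < n}`. -/
def cutoff (n : ℕ) : ℕ → ZMod 2 := fun m => if m < n then 1 else 0

/-- The action of the letter at time `t` on the tile of level `n`, with reflecting ends. -/
def truncAct (s : ℕ → Letter) (n t : ℕ) (v : Seq) : Seq :=
  toggle (s t).ty (cutoff n * (s t).op) v

/-- The time and the position of the trajectory through `v` at time `t` in the tile of level `n`
immediately after its last visit to the end `strong n`, or at time `0`. -/
def label (s : ℕ → Letter) (n : ℕ) : ℕ → Seq → ℕ × Seq
  | 0, v => (0, v)
  | t + 1, v =>
    if (s t).ty = n % 3 ∧ v = strong n then (t + 1, v) else label s n t (truncAct s n t v)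

lemma cutoff_mul_of_lt {n m : ℕ} (o : ℕ → ZMod 2) (h : m < n) : (cutoff n * o) m = o m := by
  simp [cutoff, h]

lemma cutoff_mul_of_le {n m : ℕ} (o : ℕ → ZMod 2) (h : n ≤ m) : (cutoff n * o) m = 0 := by
  simp [cutoff, not_lt.2 h]

lemma deep_zero : deep 0 = 0 := rfl

lemma truncAct_truncAct (s : ℕ → Letter) (n t : ℕ) (v : Seq) :
    truncAct s n t (truncAct s n t v) = v := toggle_involutive _ _ _

lemma truncAct_mem (s : ℕ → Letter) {n : ℕ} (t : ℕ) {v : Seq} (hv : v ∈ tile n) :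
    truncAct s n t v ∈ tile n :=
  toggle_mem_tile hv fun _ hm => cutoff_mul_of_le _ hm

lemma truncAct_strong (s : ℕ → Letter) {n k t : ℕ} (hk : n ≤ k) (ht : (s t).ty = k % 3) :
    truncAct s n t (strong k) = strong k :=
  toggle_zero ht.symm (strong_switchable k) (cutoff_mul_of_le _ hk)

lemma truncAct_eq_strong_iff (s : ℕ → Letter) {n k t : ℕ} {v : Seq} (hk : n ≤ k)
    (ht : (s t).ty = k % 3) : truncAct s n t v = strong k ↔ v = strong k := by
  refine ⟨fun h => ?_, fun h => ?_⟩
  · rw [← truncAct_truncAct s n t v, h, truncAct_strong s hk ht]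
  · rw [h, truncAct_strong s hk ht]

lemma label_succ_of_not (s : ℕ → Letter) {n t : ℕ} {v : Seq}
    (h : ¬ ((s t).ty = n % 3 ∧ v = strong n)) :
    label s n (t + 1) v = label s n t (truncAct s n t v) := by
  rw [label, if_neg h]

lemma label_succ_truncAct (s : ℕ → Letter) {n t : ℕ} {v : Seq}
    (h : ¬ ((s t).ty = n % 3 ∧ v = strong n)) :
    label s n (t + 1) (truncAct s n t v) = label s n t v := by
  rw [label_succ_of_not, truncAct_truncAct]
  rintro ⟨ht, hv⟩
  exact h ⟨ht, (truncAct_eq_strong_iff s le_rfl ht).1 hv⟩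

lemma label_fst_le (s : ℕ → Letter) (n t : ℕ) (v : Seq) : (label s n t v).1 ≤ t := by
  induction t generalizing v with
  | zero => simp [label]
  | succ t ih =>
    rw [label]
    split_ifs
    · rfl
    · exact (ih _).trans (Nat.le_succ t)

lemma label_injOn (s : ℕ → Letter) {n t : ℕ} {v w : Seq}
    (h : label s n t v = label s n t w) : v = w := by
  induction t generalizing v w with
  | zero => simpa [label] using h
  | succ t ih =>
    rw [label, label] at h
    split_ifs at h with h1 h2 h2
    · rw [h1.2, h2.2]
    · have := label_fst_le s n t (truncAct s n t w)
      rw [← h] at this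
      simp at this
    · have := label_fst_le s n t (truncAct s n t v)
      rw [h] at this
      simp at this
    · rw [← truncAct_truncAct s n t v, ih h, truncAct_truncAct]

lemma label_spec (s : ℕ → Letter) (n t : ℕ) {v : Seq} (hv : v ∈ tile n) :
    label s n (label s n t v).1 (label s n t v).2 = label s n t v ∧
      (label s n t v).2 ∈ tile n ∧ ((label s n t v).1 = 0 ∨ ∃ r < t, (s r).ty = n % 3 ∧
        label s n t v = (r + 1, strong n)) := by
  induction t generalizing v with
  | zero => exact ⟨by simp [label], by simpa [label] using hv, Or.inl (by simp [label])⟩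
  | succ t ih =>
    by_cases h : (s t).ty = n % 3 ∧ v = strong n
    · have : label s n (t + 1) v = (t + 1, strong n) := by rw [label, if_pos h, h.2]
      rw [this]
      refine ⟨by rw [← h.2] at this ⊢; exact this, strong_mem_tile (by omega), Or.inr
        ⟨t, by omega, h.1, rfl⟩⟩
    · rw [label_succ_of_not s h]
      obtain ⟨h1, h2, h3⟩ := ih (truncAct_mem s t hv)
      refine ⟨h1, h2, h3.imp_right ?_⟩
      rintro ⟨r, hr, h4⟩
      exact ⟨r, by omega, h4⟩

/-- A label in use at time `t'` that was created before time `t` is in use at time `t`. -/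
lemma exists_label_eq (s : ℕ → Letter) {n t t' : ℕ} {v : Seq} (h : t ≤ t') (hv : v ∈ tile n)
    (hl : (label s n t' v).1 ≤ t) : ∃ u ∈ tile n, label s n t u = label s n t' v := by
  induction t', h using Nat.le_induction generalizing v with
  | base => exact ⟨v, hv, rfl⟩
  | succ t' ht ih =>
    have hne : ¬ ((s t').ty = n % 3 ∧ v = strong n) := fun hc => by
      rw [label, if_pos hc] at hl
      simp at hl
      omega
    rw [label_succ_of_not s hne] at hl ⊢
    exact ih (truncAct_mem s t' hv) hl

/-- A label ends at the next visit to the end `strong n`. -/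
lemma label_ne_of_lt (s : ℕ → Letter) {n t t' : ℕ} {v : Seq} (h : t < t') (hv : v ∈ tile n)
    (ht : (s t).ty = n % 3) : label s n t' v ≠ label s n t (strong n) := by
  intro he
  have hle : (label s n t' v).1 ≤ t := by
    rw [he]
    exact label_fst_le s n t _
  obtain ⟨u, hu, hl⟩ := exists_label_eq s (show t + 1 ≤ t' by omega) hv (by omega)
  by_cases hc : (s t).ty = n % 3 ∧ u = strong n
  · rw [label, if_pos hc] at hl
    rw [← hl] at hle
    simp at hle
  · rw [label_succ_of_not s hc, he] at hl
    exact hc ⟨ht, (truncAct_eq_strong_iff s le_rfl ht).1 (label_injOn s hl)⟩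

/-- The total action on the tail of the letters read at the end `strong (n + 1)` during the
times in `T` by the trajectory carrying the label `l`. -/
def tailSum (s : ℕ → Letter) (n : ℕ) (T : Finset ℕ) (l : ℕ × Seq) : Fin 3 → ZMod 2 :=
  ∑ r ∈ T with (s r).ty = (n + 1) % 3 ∧ label s n r (strong (n + 1)) = l, (s r).chi

lemma tailSum_Ico_succ (s : ℕ → Letter) (n : ℕ) {t t' : ℕ} (l : ℕ × Seq) (h : t ≤ t') :
    tailSum s n (Finset.Ico t (t' + 1)) l = tailSum s n (Finset.Ico t t') l +
      if (s t').ty = (n + 1) % 3 ∧ label s n t' (strong (n + 1)) = l then (s t').chi else 0 := by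
  unfold tailSum
  rw [Finset.sum_filter, Finset.sum_filter, Finset.sum_Ico_succ_top h]

/-- On sequences with a strong prefix, `toggle` depends only on the values of `o` from `3` on. -/
lemma toggle_congr_of_hasStrongPrefix {n i : ℕ} {o o' : ℕ → ZMod 2} {Y : Seq} (hn : 3 ≤ n)
    (hi : n % 3 = i) (hY : HasStrongPrefix n Y) (h : ∀ m, 3 ≤ m → o m = o' m) :
    toggle i o Y = toggle i o' Y := by
  by_cases hex : ∃ m, m % 3 = i ∧ Switchable m Y
  · obtain ⟨m, hm, hs⟩ := hex
    rw [toggle_of_switchable o hm hs, toggle_of_switchable o' hm hs, h m]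
    by_contra hlt
    have := hY (m + 1) (by omega)
    rw [hs.2] at this
    simp at this
    omega
  · rw [toggle_of_not _ fun m hm hs => hex ⟨m, hm, hs⟩,
      toggle_of_not _ fun m hm hs => hex ⟨m, hm, hs⟩]

/-- As long as a trajectory in a tile keeps its label, its continuation by a tail follows it, and
the tail is changed by the letters read at the end `strong (n + 1)`. -/
lemma tracking {α : Type*} (s : ℕ → Letter) {n : ℕ} (hn : 2 ≤ n) (e : ℕ → ZMod 2)
    (he : ∀ m < n, e m = 1) {Y : Seq} (hY : HasStrongPrefix (n + 1) Y) (H : ℕ → Seq → α)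
    {t t' : ℕ} (h : t ≤ t')
    (hH : ∀ r, t ≤ r → r < t' → ∀ v ∈ tile n, ∀ x : Fin 3 → ZMod 2,
      H (r + 1) (toggle (s r).ty (e * (s r).op)
          (splice (n + 1) v (toggle ((n + 1) % 3) (e * deep x) Y))) =
        H r (splice (n + 1) v (toggle ((n + 1) % 3) (e * deep x) Y)))
    {u v : Seq} (hv : v ∈ tile n) (hl : label s n t' v = label s n t u) :
    H t' (splice (n + 1) v (toggle ((n + 1) % 3)
      (e * deep (tailSum s n (Finset.Ico t t') (label s n t u))) Y)) =
      H t (splice (n + 1) u Y) := by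
  induction t', h using Nat.le_induction generalizing v with
  | base =>
    rw [label_injOn s hl]
    simp [tailSum, deep_zero, toggle_zero_fun]
  | succ t' ht ih =>
    have hne : ¬ ((s t').ty = n % 3 ∧ v = strong n) := fun hc => by
      have := label_fst_le s n t u
      rw [← hl, label, if_pos hc] at this
      simp at this
      omega
    have hlab := hl
    rw [label_succ_of_not s hne] at hl
    have hv' := truncAct_mem s t' hv
    have key := ih (fun r hr hr' => hH r hr (by omega)) hv' hl
    have hstep := hH t' ht (by omega) _ hv' (tailSum s n (Finset.Ico t t') (label s n t u))
    rw [key] at hstep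
    rw [← hstep]
    congr 1
    have hne' : ¬ ((s t').ty = n % 3 ∧ truncAct s n t' v = strong n) := fun hc =>
      hne ⟨hc.1, (truncAct_eq_strong_iff s le_rfl hc.1).1 hc.2⟩
    rw [toggle_splice (o' := cutoff n * (s t').op) hv' (toggle_hasStrongPrefix _ rfl hY)
      (fun m hm => by simp [cutoff, hm, he m hm]) (fun m hm => cutoff_mul_of_le _ hm) hne'
      (s t').ty_lt]
    rw [show toggle (s t').ty (cutoff n * (s t').op) (truncAct s n t' v) = v from
      truncAct_truncAct s n t' v, tailSum_Ico_succ s n _ ht]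
    by_cases hS : (s t').ty = (n + 1) % 3 ∧ truncAct s n t' v = strong (n + 1)
    · rw [if_pos hS, if_pos ⟨hS.1, by rw [← hS.2, hl]⟩, hS.1, toggle_toggle]
      congr 1
      apply toggle_congr_of_hasStrongPrefix (show 3 ≤ n + 1 by omega) rfl hY
      intro m hm
      simp only [Pi.add_apply, Pi.mul_apply, deep, (s t').op_eq m hm]
      ring
    · rw [if_neg hS, if_neg, add_zero]
      rintro ⟨h1, h2⟩
      exact hS ⟨h1, label_injOn s (hl.trans h2.symm)⟩

/-- The times before `R` of the letters acting at the end `strong (n + 1)` of the tile of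
level `n`. -/
def endTimes (s : ℕ → Letter) (n R : ℕ) : Finset ℕ :=
  {t ∈ Finset.range R | (s t).ty = (n + 1) % 3}

/-- The labels of the trajectories visiting the end `strong (n + 1)` before time `R`. -/
def endLabels (s : ℕ → Letter) (n R : ℕ) : Finset (ℕ × Seq) :=
  (endTimes s n R).image fun t => label s n t (strong (n + 1))

/-- The end labels whose total action on the tail has nonzero `k`-th coordinate. -/
def activeLabels (s : ℕ → Letter) (n R : ℕ) (k : Fin 3) : Finset (ℕ × Seq) :=
  {l ∈ endLabels s n R | tailSum s n (Finset.range R) l k ≠ 0}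

lemma exists_factor {ι α β : Type*} [Nonempty β] {T : Set ι} {f : ι → α} {g : ι → β}
    (h : ∀ t ∈ T, ∀ t' ∈ T, f t = f t' → g t = g t') : ∃ φ : α → β, ∀ t ∈ T, φ (f t) = g t := by
  refine ⟨fun a => if ha : ∃ t ∈ T, f t = a then g ha.choose else Classical.arbitrary β,
    fun t ht => ?_⟩
  have ha : ∃ t' ∈ T, f t' = f t := ⟨t, ht, rfl⟩
  simp only [dif_pos ha]
  exact h _ ha.choose_spec.1 _ ht ha.choose_spec.2

lemma card_image_le_of_factor {ι α β : Type*} [Nonempty β] [DecidableEq α] [DecidableEq β]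
    {T : Finset ι} {f : ι → α} {g : ι → β}
    (h : ∀ t ∈ T, ∀ t' ∈ T, f t = f t' → g t = g t') :
    (T.image g).card ≤ (T.image f).card := by
  obtain ⟨φ, hφ⟩ := exists_factor (T := (T : Set ι)) h
  rw [show T.image g = (T.image f).image φ by
    rw [Finset.image_image]
    exact Finset.image_congr fun t ht => (hφ t ht).symm]
  exact Finset.card_image_le

lemma card_filter_sum_le_of_factor {ι α β M : Type*} [Nonempty β] [AddCommMonoid M]
    [DecidableEq α] [DecidableEq β] [DecidableEq M] {T : Finset ι} {f : ι → α} {g : ι → β}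
    (h : ∀ t ∈ T, ∀ t' ∈ T, f t = f t' → g t = g t') (w : ι → M) :
    {b ∈ T.image g | ∑ t ∈ T with g t = b, w t ≠ 0}.card ≤
      {a ∈ T.image f | ∑ t ∈ T with f t = a, w t ≠ 0}.card := by
  obtain ⟨φ, hφ⟩ := exists_factor (T := (T : Set ι)) h
  refine (Finset.card_le_card (t := Finset.image φ _) fun b hb => ?_).trans
    Finset.card_image_le
  rw [Finset.mem_filter] at hb
  have hsum := Finset.sum_fiberwise_of_maps_to (s := {t ∈ T | g t = b}) (t := T.image f)
    (g := f) (fun t ht => Finset.mem_image_of_mem f (Finset.mem_filter.1 ht).1) w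
  obtain ⟨a, ha, hne⟩ := Finset.exists_ne_zero_of_sum_ne_zero (hsum.trans_ne hb.2)
  obtain ⟨t, ht, -⟩ := Finset.exists_ne_zero_of_sum_ne_zero hne
  simp only [Finset.mem_filter] at ht
  have hφa : φ a = b := by rw [← ht.2, hφ t ht.1.1, ht.1.2]
  refine Finset.mem_image.2 ⟨a, Finset.mem_filter.2 ⟨ha, ?_⟩, hφa⟩
  convert hne using 2
  ext t'
  simp only [Finset.mem_filter]
  constructor
  · rintro ⟨h1, h2⟩
    exact ⟨⟨h1, by rw [← hφ t' h1, h2, hφa]⟩, h2⟩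
  · rintro ⟨⟨h1, -⟩, h2⟩
    exact ⟨h1, h2⟩

lemma tailSum_range (s : ℕ → Letter) (n R : ℕ) (l : ℕ × Seq) :
    tailSum s n (Finset.range R) l =
      ∑ t ∈ endTimes s n R with label s n t (strong (n + 1)) = l, (s t).chi := by
  rw [tailSum, endTimes, Finset.filter_filter]

lemma label_add_three_of_le (s : ℕ → Letter) {n t t' : ℕ} (hn : 2 ≤ n) (h : t ≤ t')
    (hl : label s n t (strong (n + 1)) = label s n t' (strong (n + 1))) :
    label s (n + 3) t (strong (n + 4)) = label s (n + 3) t' (strong (n + 4)) := by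
  have hpre : HasStrongPrefix (n + 1) (strong (n + 4)) :=
    (strong_hasStrongPrefix (n + 4)).of_le (by omega) (by omega)
  have hfix : ∀ x : Fin 3 → ZMod 2,
      toggle ((n + 1) % 3) (cutoff (n + 3) * deep x) (strong (n + 4)) = strong (n + 4) :=
    fun x => toggle_zero (m := n + 4) (by omega) (strong_switchable _)
      (cutoff_mul_of_le _ (by omega))
  have key := tracking s hn (cutoff (n + 3)) (fun m hm => by simp [cutoff]; omega) hpre
    (fun r w => label s (n + 3) r w) h (fun r _ _ v _ x => ?_)
    (strong_mem_tile (show n + 1 ≤ n + 1 by omega)) hl.symm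
  · simp only [hfix, splice_self_of_hasStrongPrefix hpre] at key
    exact key.symm
  · rw [hfix]
    refine label_succ_truncAct s ?_
    rintro ⟨-, hc⟩
    have := congrFun hc (n + 2)
    simp [splice, strong] at this

lemma label_add_three (s : ℕ → Letter) {n t t' : ℕ} (hn : 2 ≤ n)
    (hl : label s n t (strong (n + 1)) = label s n t' (strong (n + 1))) :
    label s (n + 3) t (strong (n + 4)) = label s (n + 3) t' (strong (n + 4)) := by
  rcases le_total t t' with h | h
  · exact label_add_three_of_le s hn h hl
  · exact (label_add_three_of_le s hn h hl.symm).symm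

lemma endTimes_add_three (s : ℕ → Letter) (n R : ℕ) :
    endTimes s (n + 3) R = endTimes s n R := by
  rw [endTimes, endTimes, show (n + 3 + 1) % 3 = (n + 1) % 3 by omega]

lemma card_endLabels_add_three (s : ℕ → Letter) {n : ℕ} (hn : 2 ≤ n) (R : ℕ) :
    (endLabels s (n + 3) R).card ≤ (endLabels s n R).card := by
  rw [endLabels, endLabels, endTimes_add_three]
  exact card_image_le_of_factor fun t _ t' _ h => label_add_three s hn h

lemma card_activeLabels_add_three (s : ℕ → Letter) {n : ℕ} (hn : 2 ≤ n) (R : ℕ) (k : Fin 3) :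
    (activeLabels s (n + 3) R k).card ≤ (activeLabels s n R k).card := by
  simp only [activeLabels, endLabels, tailSum_range, endTimes_add_three, Finset.sum_apply]
  exact card_filter_sum_le_of_factor (fun t _ t' _ h => label_add_three s hn h)
    fun t => (s t).chi k

lemma sum_card_activeLabels_le (s : ℕ → Letter) (n R : ℕ) :
    ∑ k, (activeLabels s n R k).card ≤ 2 * (endLabels s n R).card := by
  have h : ∀ l, (∑ k : Fin 3, if tailSum s n (Finset.range R) l k ≠ 0 then 1 else 0) ≤ 2 := by
    intro l
    have h0 : tailSum s n (Finset.range R) l 0 + tailSum s n (Finset.range R) l 1 +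
        tailSum s n (Finset.range R) l 2 = 0 := by
      simp only [tailSum, Finset.sum_apply, ← Finset.sum_add_distrib]
      exact Finset.sum_eq_zero fun t _ => (s t).chi_sum
    have key : ∀ x y z : ZMod 2, x + y + z = 0 →
        (if x ≠ 0 then 1 else 0) + (if y ≠ 0 then 1 else 0) + (if z ≠ 0 then 1 else 0) ≤ 2 := by
      decide
    rw [Fin.sum_univ_three]
    exact key _ _ _ h0
  calc ∑ k, (activeLabels s n R k).card
      = ∑ l ∈ endLabels s n R, ∑ k : Fin 3,
          if tailSum s n (Finset.range R) l k ≠ 0 then 1 else 0 := by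
        rw [Finset.sum_comm]
        exact Finset.sum_congr rfl fun k _ => Finset.card_filter _ _
    _ ≤ ∑ l ∈ endLabels s n R, 2 := Finset.sum_le_sum fun l _ => h l
    _ = 2 * (endLabels s n R).card := by rw [Finset.sum_const, smul_eq_mul, mul_comm]

lemma tailSum_range_eq_Ico (s : ℕ → Letter) {n t R : ℕ} (hR : t < R) (ht : (s t).ty = n % 3) :
    tailSum s n (Finset.range R) (label s n t (strong n)) =
      tailSum s n (Finset.Ico (label s n t (strong n)).1 t) (label s n t (strong n)) := by
  unfold tailSum
  congr 1
  ext r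
  simp only [Finset.mem_filter, Finset.mem_range, Finset.mem_Ico]
  constructor
  · rintro ⟨h1, h2, h3⟩
    refine ⟨⟨h3 ▸ label_fst_le s n r _, ?_⟩, h2, h3⟩
    by_contra hlt
    rcases eq_or_lt_of_le (not_lt.1 hlt) with h4 | h4
    · rw [← h4] at h2
      omega
    · exact label_ne_of_lt s h4 (strong_mem_tile le_rfl) ht h3
  · rintro ⟨⟨h1, h2⟩, h3⟩
    exact ⟨by omega, h3⟩

lemma splice_strong_flipAt (n : ℕ) :
    splice (n + 1) (strong n) (flipAt (n + 1) (strong (n + 1))) = strong (n + 3) := by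
  funext j
  by_cases h : j < n + 1
  · simp only [splice, if_pos h, strong]
    congr 1
    apply propext
    omega
  · simp only [splice, if_neg h, flipAt, strong]
    by_cases h1 : j = n + 1
    · subst h1
      simp
    · rw [if_neg h1]
      congr 1
      apply propext
      omega

lemma label_add_two_eq (s : ℕ → Letter) {n t : ℕ} (hn : 2 ≤ n) {l : ℕ × Seq}
    (hl : l = label s n t (strong n))
    (h0 : tailSum s n (Finset.Ico l.1 t) l (Fin.ofNat 3 ((n + 1) / 3)) = 0) :
    label s (n + 2) t (strong (n + 3)) =
      label s (n + 2) l.1 (splice (n + 1) l.2 (flipAt (n + 1) (strong (n + 1)))) := by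
  have hsw : Switchable (n + 1) (flipAt (n + 1) (strong (n + 1))) :=
    (strong_switchable (n + 1)).flipAt
  have hspec := label_spec s n t (strong_mem_tile (show n ≤ n + 1 by omega))
  rw [← hl] at hspec
  have key := tracking s hn (cutoff (n + 2)) (fun m hm => by simp [cutoff]; omega) hsw.1
    (fun r w => label s (n + 2) r w) (hl ▸ label_fst_le s n t _ : l.1 ≤ t)
    (fun r _ _ v hv x => ?_)
    (strong_mem_tile (show n ≤ n + 1 by omega)) (hl.symm.trans hspec.1.symm)
  · rw [hspec.1, toggle_zero rfl hsw, splice_strong_flipAt] at key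
    · exact key
    · rw [cutoff_mul_of_lt _ (by omega)]
      exact h0
  · refine label_succ_truncAct s ?_
    rintro ⟨-, hc⟩
    have h1 := congrFun hc n
    simp only [splice, if_pos (show n < n + 1 by omega), hv.2 n le_rfl, strong] at h1
    simp at h1
lemma label_add_two_cases (s : ℕ → Letter) {n R : ℕ} (hn : 2 ≤ n) {ψ : ℕ × Seq → ℕ × Seq}
    (hψ : ∀ t ∈ {t | (s t).ty = n % 3}, ψ (label s n t (strong n)) =
      label s (n + 2) t (strong (n + 3))) {t : ℕ} (hR : t < R) (ht : (s t).ty = n % 3) :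
    label s (n + 2) t (strong (n + 3)) ∈
      (fun v => label s (n + 2) 0 (splice (n + 1) v (flipAt (n + 1) (strong (n + 1))))) '' tile n ∪
        ψ '' activeLabels s n R (Fin.ofNat 3 ((n + 1) / 3)) := by
  induction t using Nat.strong_induction_on with
  | _ t ih =>
    by_cases h0 : tailSum s n (Finset.range R) (label s n t (strong n))
        (Fin.ofNat 3 ((n + 1) / 3)) = 0
    · rw [tailSum_range_eq_Ico s hR ht] at h0
      rw [label_add_two_eq s hn rfl h0]
      obtain ⟨-, hmem, hc⟩ := label_spec s n t (strong_mem_tile (show n ≤ n + 1 by omega))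
      rcases hc with hc | ⟨r, hr, hty, hl⟩
      · rw [hc]
        exact Or.inl ⟨_, hmem, rfl⟩
      · rw [hl]
        simp only
        rw [splice_strong_flipAt, label_succ_of_not, truncAct_strong s (by omega) (by omega)]
        · exact ih r hr (by omega) hty
        · rintro ⟨h1, -⟩
          omega
    · refine Or.inr ⟨_, ?_, hψ t ht⟩
      simp only [activeLabels, Finset.coe_filter, Set.mem_ofPred_eq]
      refine ⟨?_, h0⟩
      obtain ⟨r, hr, -⟩ := Finset.exists_ne_zero_of_sum_ne_zero
        (s := {r ∈ Finset.range R | (s r).ty = (n + 1) % 3 ∧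
          label s n r (strong (n + 1)) = label s n t (strong n)}) (f := fun r => (s r).chi)
        (fun h => h0 (by rw [tailSum, h]; rfl))
      simp only [Finset.mem_filter, Finset.mem_range] at hr
      rw [← hr.2.2]
      exact Finset.mem_image_of_mem _ (Finset.mem_filter.2 ⟨Finset.mem_range.2 hr.1, hr.2.1⟩)

lemma tile_zero : tile 0 = {strong 0} := by
  ext v
  refine ⟨fun h => ?_, fun h => ?_⟩
  · exact eq_strong h (fun j hj => absurd hj (Nat.not_lt_zero j)) (Or.inl rfl)
  · rw [Set.mem_singleton_iff.1 h]
    exact strong_mem_tile (by omega)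

lemma tile_one_subset : tile 1 ⊆ {strong 0, flipAt 0 (strong 0)} := by
  intro v hv
  by_cases h : v 0 = true
  · right
    funext j
    by_cases hj : j = 0
    · simp [hj, h, flipAt, strong]
    · simp [flipAt, strong, hj, hv.2 j (by omega)]
  · left
    funext j
    by_cases hj : j = 0
    · simpa [hj, strong] using h
    · simp [strong, hv.2 j (by omega)]

lemma tile_add_two_subset (n : ℕ) :
    tile (n + 2) ⊆ tile (n + 1) ∪ flipAt (n + 1) '' tile n := by
  intro v hv
  by_cases h : v (n + 1) = true
  · right
    have hn : v n = false := by
      have := hv.1 n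
      simpa [h] using this
    refine ⟨flipAt (n + 1) v, ⟨fun j hj => ?_, fun j hj => ?_⟩, flipAt_flipAt _ _⟩
    · have h1 := hv.1 j
      simp only [flipAt] at hj
      split_ifs at hj with h2 h3 h3
      · omega
      · rw [h2, h] at hj
        simp at hj
      · rw [h3, h] at hj
        simp at hj
      · exact h1 hj
    · by_cases h1 : j = n + 1
      · simp [flipAt, h1, h]
      · rcases eq_or_ne j n with h2 | h2
        · simp [flipAt, h2, hn]
        · simp [flipAt, h1, hv.2 j (by omega)]
  · left
    refine ⟨hv.1, fun j hj => ?_⟩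
    rcases eq_or_ne j (n + 1) with h1 | h1
    · simpa [h1] using h
    · exact hv.2 j (by omega)

lemma tile_finite : ∀ n, (tile n).Finite
  | 0 => tile_zero ▸ Set.finite_singleton _
  | 1 => (Set.toFinite _).subset tile_one_subset
  | n + 2 => ((tile_finite (n + 1)).union ((tile_finite n).image _)).subset
      (tile_add_two_subset n)

lemma ncard_tile_le : ∀ n, (tile n).ncard ≤ Nat.fib (n + 2)
  | 0 => by simp [tile_zero]
  | 1 => (Set.ncard_le_ncard tile_one_subset (Set.toFinite _)).trans (Set.ncard_insert_le _ _)
      |>.trans (by simp [Nat.fib_add_two])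
  | n + 2 => calc
      (tile (n + 2)).ncard ≤ (tile (n + 1) ∪ flipAt (n + 1) '' tile n).ncard :=
        Set.ncard_le_ncard (tile_add_two_subset n)
          ((tile_finite (n + 1)).union ((tile_finite n).image _))
      _ ≤ (tile (n + 1)).ncard + (flipAt (n + 1) '' tile n).ncard := Set.ncard_union_le _ _
      _ ≤ Nat.fib (n + 3) + Nat.fib (n + 2) :=
        add_le_add (ncard_tile_le (n + 1))
          ((Set.ncard_image_le (tile_finite n)).trans (ncard_tile_le n))
      _ = Nat.fib (n + 2 + 2) := by rw [Nat.fib_add_two (n := n + 2), add_comm]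

lemma card_endLabels_add_two (s : ℕ → Letter) {n : ℕ} (hn : 2 ≤ n) (R : ℕ) :
    (endLabels s (n + 2) R).card ≤
      (activeLabels s n R (Fin.ofNat 3 ((n + 1) / 3))).card + (tile n).ncard := by
  obtain ⟨ψ, hψ⟩ := exists_factor (T := {t | (s t).ty = n % 3})
    (f := fun t => label s n t (strong n)) (g := fun t => label s (n + 2) t (strong (n + 3)))
    fun t ht t' ht' h => by
      rcases lt_trichotomy t t' with h1 | h1 | h1
      · exact absurd h.symm (label_ne_of_lt s h1 (strong_mem_tile (by omega)) ht)
      · rw [h1]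
      · exact absurd h (label_ne_of_lt s h1 (strong_mem_tile (by omega)) ht')
  have hsub : (endLabels s (n + 2) R : Set (ℕ × Seq)) ⊆ _ ∪ _ := fun l hl => by
    obtain ⟨t, ht, rfl⟩ := Finset.mem_image.1 hl
    rw [endTimes, Finset.mem_filter, Finset.mem_range] at ht
    exact label_add_two_cases s hn hψ ht.1 (by omega)
  calc (endLabels s (n + 2) R).card = (endLabels s (n + 2) R : Set (ℕ × Seq)).ncard :=
        (Set.ncard_coe_finset _).symm
    _ ≤ _ := Set.ncard_le_ncard hsub
        (((tile_finite n).image _).union ((Finset.finite_toSet _).image _))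
    _ ≤ _ := Set.ncard_union_le _ _
    _ ≤ (tile n).ncard + (activeLabels s n R (Fin.ofNat 3 ((n + 1) / 3))).card :=
        add_le_add (Set.ncard_image_le (tile_finite n))
          ((Set.ncard_image_le (Finset.finite_toSet _)).trans (Set.ncard_coe_finset _).le)
    _ = _ := add_comm _ _

lemma tile_subset_tile {n k : ℕ} (h : n ≤ k) : tile n ⊆ tile k :=
  fun _ hv => ⟨hv.1, fun j hj => hv.2 j (h.trans hj)⟩

lemma ncard_tile_mono {n k : ℕ} (h : n ≤ k) : (tile n).ncard ≤ (tile k).ncard :=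
  Set.ncard_le_ncard (tile_subset_tile h) (tile_finite k)

lemma card_endLabels_add_eight (s : ℕ → Letter) {n : ℕ} (hn : 2 ≤ n) (R : ℕ) :
    3 * (endLabels s (n + 8) R).card ≤
      2 * (endLabels s n R).card + 3 * (tile (n + 6)).ncard := by
  have h1 := card_endLabels_add_two s hn R
  have h2 := card_endLabels_add_two s (show 2 ≤ n + 3 by omega) R
  have h3 := card_endLabels_add_two s (show 2 ≤ n + 6 by omega) R
  have h4 := card_endLabels_add_three s (show 2 ≤ n + 2 by omega) R
  have h5 := card_endLabels_add_three s (show 2 ≤ n + 5 by omega) R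
  have h6 := card_activeLabels_add_three s hn R (Fin.ofNat 3 ((n + 3 + 1) / 3))
  have h7 := card_activeLabels_add_three s hn R (Fin.ofNat 3 ((n + 6 + 1) / 3))
  have h8 := card_activeLabels_add_three s (show 2 ≤ n + 3 by omega) R
    (Fin.ofNat 3 ((n + 6 + 1) / 3))
  have h9 := sum_card_activeLabels_le s n R
  have h10 := ncard_tile_mono (show n ≤ n + 6 by omega)
  have h11 := ncard_tile_mono (show n + 3 ≤ n + 6 by omega)
  have h12 : ∑ k, (activeLabels s n R k).card =
      (activeLabels s n R (Fin.ofNat 3 ((n + 1) / 3))).card +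
      (activeLabels s n R (Fin.ofNat 3 ((n + 3 + 1) / 3))).card +
      (activeLabels s n R (Fin.ofNat 3 ((n + 6 + 1) / 3))).card := by
    rw [show (n + 3 + 1) / 3 = (n + 1) / 3 + 1 by omega,
      show (n + 6 + 1) / 3 = (n + 1) / 3 + 2 by omega, Fin.sum_univ_three]
    have : (n + 1) / 3 % 3 < 3 := Nat.mod_lt _ (by omega)
    obtain h | h | h : (n + 1) / 3 % 3 = 0 ∨ (n + 1) / 3 % 3 = 1 ∨ (n + 1) / 3 % 3 = 2 := by
      omega
    · rw [show Fin.ofNat 3 ((n + 1) / 3) = 0 from Fin.ext h,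
        show Fin.ofNat 3 ((n + 1) / 3 + 1) = 1 from Fin.ext (by simp; omega),
        show Fin.ofNat 3 ((n + 1) / 3 + 2) = 2 from Fin.ext (by simp; omega)]
    · rw [show Fin.ofNat 3 ((n + 1) / 3) = 1 from Fin.ext h,
        show Fin.ofNat 3 ((n + 1) / 3 + 1) = 2 from Fin.ext (by simp; omega),
        show Fin.ofNat 3 ((n + 1) / 3 + 2) = 0 from Fin.ext (by simp; omega)]
      ring
    · rw [show Fin.ofNat 3 ((n + 1) / 3) = 2 from Fin.ext h,
        show Fin.ofNat 3 ((n + 1) / 3 + 1) = 0 from Fin.ext (by simp; omega),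
        show Fin.ofNat 3 ((n + 1) / 3 + 2) = 1 from Fin.ext (by simp; omega)]
      ring
  simp only [add_assoc, Nat.reduceAdd] at h1 h2 h3 h4 h5 h6 h7 h8 h9 h10 h11 h12
  omega

lemma card_endLabels_le (s : ℕ → Letter) {n : ℕ} (hn : 2 ≤ n) (R k : ℕ) :
    ((endLabels s (n + 8 * k) R).card : ℝ) ≤
      (2 / 3) ^ k * R + 3 * (tile (n + 8 * k)).ncard := by
  induction k with
  | zero =>
    have : (endLabels s n R).card ≤ R :=
      Finset.card_image_le.trans ((Finset.card_filter_le _ _).trans (Finset.card_range R).le)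
    have : ((endLabels s n R).card : ℝ) ≤ R := by exact_mod_cast this
    have h0 : (0 : ℝ) ≤ (tile n).ncard := by positivity
    simp only [mul_zero, add_zero, pow_zero, one_mul]
    linarith
  | succ k ih =>
    have h : (3 : ℝ) * (endLabels s (n + 8 * k + 8) R).card ≤
        2 * (endLabels s (n + 8 * k) R).card + 3 * (tile (n + 8 * k + 6)).ncard := by
      exact_mod_cast card_endLabels_add_eight s (show 2 ≤ n + 8 * k by omega) R
    have h1 : ((tile (n + 8 * k)).ncard : ℝ) ≤ (tile (n + 8 * k + 8)).ncard := by
      exact_mod_cast ncard_tile_mono (by omega)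
    have h2 : ((tile (n + 8 * k + 6)).ncard : ℝ) ≤ (tile (n + 8 * k + 8)).ncard := by
      exact_mod_cast ncard_tile_mono (by omega)
    rw [show n + 8 * (k + 1) = n + 8 * k + 8 by ring, pow_succ]
    linarith

lemma fib_add_eight_le : ∀ n : ℕ, 21 * Nat.fib (n + 8) ≤ 34 * Nat.fib (n + 7)
  | 0 => by decide
  | 1 => by decide
  | n + 2 => by
    have h1 := fib_add_eight_le n
    have h2 := fib_add_eight_le (n + 1)
    have h3 := Nat.fib_add_two (n := n + 7)
    have h4 := Nat.fib_add_two (n := n + 8)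
    simp only [add_assoc, Nat.reduceAdd] at h1 h2 h3 h4 ⊢
    omega

lemma fib_le (k : ℕ) : Nat.fib (8 * k + 7) ≤ 13 * 47 ^ k := by
  induction k with
  | zero => decide
  | succ k ih =>
    have h1 := fib_add_eight_le (8 * k)
    have h2 := Nat.fib_add (8 * k + 7) 7
    rw [show Nat.fib 7 = 13 by decide, show Nat.fib (7 + 1) = 21 by decide] at h2
    rw [show 8 * (k + 1) + 7 = 8 * k + 7 + 7 + 1 by ring, pow_succ]
    simp only [add_assoc, Nat.reduceAdd] at h1 h2 ih ⊢
    omega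

/-- The action of the letters at the times `t, …, t + d - 1`. -/
def run (s : ℕ → Letter) : ℕ → ℕ → Seq → Seq
  | 0, _, w => w
  | d + 1, t, w => run s d (t + 1) (toggle (s t).ty (s t).op w)

/-- The action of the letters from time `t` up to time `R`. -/
def runTo (s : ℕ → Letter) (R t : ℕ) (w : Seq) : Seq := run s (R - t) t w

lemma runTo_self (s : ℕ → Letter) (R : ℕ) (w : Seq) : runTo s R R w = w := by
  simp [runTo, run]

lemma runTo_succ (s : ℕ → Letter) {R t : ℕ} (h : t < R) (w : Seq) :
    runTo s R (t + 1) (toggle (s t).ty (s t).op w) = runTo s R t w := by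
  rw [runTo, runTo, show R - t = R - (t + 1) + 1 by omega, run]

/-- The position congruent to `i` modulo `3` among `n - 2`, `n - 1`, `n`. -/
def near (n : ℕ) (i : Fin 3) : ℕ := n - (n + 3 - i) % 3

lemma near_le (n : ℕ) (i : Fin 3) : near n i ≤ n := Nat.sub_le _ _

lemma le_near_add_two (n : ℕ) (i : Fin 3) : n ≤ near n i + 2 := by
  unfold near
  omega

lemma near_mod {n : ℕ} (hn : 2 ≤ n) (i : Fin 3) : near n i % 3 = i := by
  unfold near
  omega

/-- The last time before `R` at which the end `strong k` of the tile of level `k - 1` carries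
the label `l`. -/
def lastTime (s : ℕ → Letter) (R k : ℕ) (l : ℕ × Seq) : ℕ :=
  {t ∈ endTimes s (k - 1) R | label s (k - 1) t (strong k) = l}.sup id

lemma lastTime_spec (s : ℕ → Letter) {R k t : ℕ} (hR : t < R) (hk : 1 ≤ k)
    (ht : (s t).ty = k % 3) :
    t ≤ lastTime s R k (label s (k - 1) t (strong k)) ∧
      lastTime s R k (label s (k - 1) t (strong k)) < R ∧
      (s (lastTime s R k (label s (k - 1) t (strong k)))).ty = k % 3 ∧
      label s (k - 1) (lastTime s R k (label s (k - 1) t (strong k))) (strong k) =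
        label s (k - 1) t (strong k) := by
  have hmem : t ∈ {r ∈ endTimes s (k - 1) R |
      label s (k - 1) r (strong k) = label s (k - 1) t (strong k)} := by
    simp only [endTimes, Finset.mem_filter, Finset.mem_range, show k - 1 + 1 = k by omega]
    exact ⟨⟨hR, ht⟩, trivial⟩
  obtain ⟨r, hr, he⟩ := Finset.exists_mem_eq_sup _ ⟨t, hmem⟩ (id : ℕ → ℕ)
  have hle : t ≤ lastTime s R k (label s (k - 1) t (strong k)) := Finset.le_sup (f := id) hmem
  rw [show lastTime s R k (label s (k - 1) t (strong k)) = r from he] at hle ⊢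
  simp only [endTimes, Finset.mem_filter, Finset.mem_range, show k - 1 + 1 = k by omega] at hr
  exact ⟨hle, hr.1.1, hr.1.2, hr.2⟩

lemma exists_runTo_lastTime (s : ℕ → Letter) {R k t : ℕ} (hR : t < R) (hk : 3 ≤ k)
    (ht : (s t).ty = k % 3) : ∃ x : Fin 3 → ZMod 2, ∀ w, HasStrongPrefix k w →
      runTo s R t w = runTo s R (lastTime s R k (label s (k - 1) t (strong k)) + 1)
        (toggle (k % 3) (deep x) w) := by
  obtain ⟨h1, h2, h3, h4⟩ := lastTime_spec s hR (by omega) ht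
  set r := lastTime s R k (label s (k - 1) t (strong k)) with hr
  obtain ⟨n, rfl⟩ : ∃ n, k = n + 1 := ⟨k - 1, by omega⟩
  rw [Nat.add_sub_cancel] at h4
  refine ⟨tailSum s n (Finset.Ico t r) (label s n t (strong (n + 1))) + (s r).chi,
    fun w hw => ?_⟩
  have key := tracking s (show 2 ≤ n by omega) 1 (fun _ _ => rfl) hw (runTo s R) h1
    (fun i _ hi v _ x => by rw [one_mul, runTo_succ s (by omega)])
    (strong_mem_tile (show n + 1 ≤ n + 1 by omega)) h4
  rw [one_mul, splice_self_of_hasStrongPrefix hw,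
    splice_self_of_hasStrongPrefix (toggle_hasStrongPrefix _ rfl hw)] at key
  rw [← key, ← runTo_succ s h2, h3, toggle_toggle]
  congr 1
  apply toggle_congr_of_hasStrongPrefix hk rfl hw
  intro m hm
  simp only [Pi.add_apply, deep, (s r).op_eq m hm]
  ring

lemma hasStrongPrefix_splice {j n : ℕ} (h : j ≤ n) (q z : Seq) :
    HasStrongPrefix j (splice n q z) ↔ HasStrongPrefix j q := by
  refine forall₂_congr fun k hk => ?_
  rw [splice, if_pos (by omega)]

/-- Away from strong prefixes, the letters act on the first `n` positions only. -/
lemma toggle_splice_of_not {n j i : ℕ} (o : ℕ → ZMod 2) {q : Seq} (hj : j ≤ n) (hi : j % 3 = i)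
    (hq : ¬ HasStrongPrefix j q) (z : Seq) :
    toggle i o (splice n q z) = splice n (toggle i o q) z := by
  have hlt : ∀ m, m % 3 = i → HasStrongPrefix m q → m + 3 ≤ j := by
    intro m hm hs
    by_contra h
    exact hq (hs.of_le (by omega) (by omega))
  by_cases hex : ∃ m, m % 3 = i ∧ Switchable m q
  · obtain ⟨m, hm, hs⟩ := hex
    have := hlt m hm hs.1
    have hs' : Switchable m (splice n q z) :=
      ⟨(hasStrongPrefix_splice (by omega) q z).2 hs.1, by
        rw [splice, if_pos (by omega)]
        exact hs.2⟩
    rw [toggle_of_switchable o hm hs, toggle_of_switchable o hm hs']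
    split_ifs
    · funext k
      simp only [flipAt, splice]
      split_ifs <;> first | rfl | omega
    · rfl
  · rw [toggle_of_not o fun m hm hs => hex ⟨m, hm, hs⟩, toggle_of_not]
    intro m hm hs
    have hmj : m + 3 ≤ j := by
      by_contra h
      exact hq ((hasStrongPrefix_splice hj q z).1 (hs.1.of_le (by omega) (by omega)))
    refine hex ⟨m, hm, (hasStrongPrefix_splice (by omega) q z).1 hs.1, ?_⟩
    have := hs.2
    rwa [splice, if_pos (by omega)] at this

lemma toggle_mem_tile_of_not {n j i : ℕ} (o : ℕ → ZMod 2) {q : Seq} (hj : j ≤ n)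
    (hi : j % 3 = i) (hq : ¬ HasStrongPrefix j q) (hqn : q ∈ tile n) :
    toggle i o q ∈ tile n := by
  refine ⟨toggle_mem i o hqn.1, fun k hk => ?_⟩
  rcases toggle_cases i o q with h | ⟨m, hm, hs, -, h⟩
  · rw [h]
    exact hqn.2 k hk
  · rw [h, flipAt, if_neg]
    · exact hqn.2 k hk
    · rintro rfl
      exact hq (hs.1.of_le (by omega) (by omega))

instance (n : ℕ) : Finite (tile n) := tile_finite n

/-- The targets of the transitions of the machines with `3 * M` nodes and window `n`: the new
content of the window, together with the node visited and the action on the tail, if any. -/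
abbrev Target (n M : ℕ) : Type := tile n × Option (Fin 3 × Fin M × (Fin 3 → ZMod 2))

/-- The transition tables of the machines with `3 * M` nodes and window `n`. -/
abbrev Machine (n M : ℕ) : Type :=
  (tile n → Target n M) × (Fin 3 × Fin M × Bool × Bool → Target n M)

/-- At most `f` steps of the work of the machine `D` starting with a given target. -/
def exec {n M : ℕ} (D : Machine n M) : ℕ → Target n M → Seq → Seq
  | f + 1, (q, some (i, m, x)), z =>
    exec D f (D.2 (i, m, toggle i (deep x) (splice n q z) (n - 2),
      toggle i (deep x) (splice n q z) (n - 1))) (toggle i (deep x) (splice n q z))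
  | _, (q, _), z => splice n q z

/-- The target `T` correctly describes the action of the letters from time `t` on, starting with
`q` in the window, if the node `(i, m)` stands for the last visit of the label `c i m`. -/
def Describes (s : ℕ → Letter) (R : ℕ) {n M : ℕ} (c : Fin 3 → Fin M → ℕ × Seq) (t : ℕ)
    (q : Seq) (T : Target n M) : Prop :=
  (∀ z, splice n q z ∈ goldenX → splice n T.1 z ∈ goldenX) ∧
  (T.2 = none → ∀ z, runTo s R t (splice n q z) = splice n T.1 z) ∧
  ∀ i m x, T.2 = some (i, m, x) → HasStrongPrefix (near n i) T.1 ∧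
    t ≤ lastTime s R (near n i) (c i m) ∧ lastTime s R (near n i) (c i m) < R ∧
    ∀ z, runTo s R t (splice n q z) = runTo s R (lastTime s R (near n i) (c i m) + 1)
      (toggle i (deep x) (splice n T.1 z))

lemma exists_describes (s : ℕ → Letter) {R n M : ℕ} (hn : 5 ≤ n)
    {c : Fin 3 → Fin M → ℕ × Seq}
    (hc : ∀ i, ∀ l ∈ endLabels s (near n i - 1) R, ∃ m, c i m = l) {t : ℕ} (ht : t ≤ R)
    {q : Seq} (hq : q ∈ tile n) : ∃ T : Target n M, Describes s R c t q T := by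
  induction ht using Nat.decreasingInduction generalizing q with
  | self => exact ⟨(⟨q, hq⟩, none), fun _ h => h, fun _ z => runTo_self s R _, by simp⟩
  | of_succ t ht ih =>
    obtain ⟨i, hi⟩ : ∃ i : Fin 3, (s t).ty = i := ⟨⟨(s t).ty, (s t).ty_lt⟩, rfl⟩
    have hmod := near_mod (show 2 ≤ n by omega) i
    have hle := le_near_add_two n i
    by_cases hp : HasStrongPrefix (near n i) q
    · obtain ⟨x, hx⟩ := exists_runTo_lastTime s ht (show 3 ≤ near n i by omega)
        (hi.trans hmod.symm)
      obtain ⟨h1, h2, -, -⟩ := lastTime_spec s ht (show 1 ≤ near n i by omega)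
        (hi.trans hmod.symm)
      obtain ⟨m, hm⟩ := hc i (label s (near n i - 1) t (strong (near n i))) (Finset.mem_image.2
        ⟨t, Finset.mem_filter.2 ⟨Finset.mem_range.2 ht, by omega⟩, by
          rw [show near n i - 1 + 1 = near n i by omega]⟩)
      refine ⟨(⟨q, hq⟩, some (i, m, x)), fun _ h => h, by simp, ?_⟩
      rintro i' m' x' h
      obtain ⟨rfl, rfl, rfl⟩ : i = i' ∧ m = m' ∧ x = x' := by simpa using h
      rw [hm]
      refine ⟨hp, h1, h2, fun z => ?_⟩
      rw [hx _ ((hasStrongPrefix_splice (near_le n i) q z).2 hp), hmod]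
    · have hstep := toggle_splice_of_not (s t).op (near_le n i) hmod hp
      obtain ⟨T, h1, h2, h3⟩ := ih (toggle_mem_tile_of_not (s t).op (near_le n i) hmod hp hq)
      have hrun : ∀ z, runTo s R t (splice n q z) =
          runTo s R (t + 1) (splice n (toggle i (s t).op q) z) := fun z => by
        rw [← hstep, ← hi, runTo_succ s ht]
      refine ⟨T, fun z hz => h1 z (hstep z ▸ toggle_mem _ _ hz),
        fun h z => (hrun z).trans (h2 h z), fun i' m x h => ?_⟩
      obtain ⟨h4, h5, h6, h7⟩ := h3 i' m x h
      exact ⟨h4, by omega, h6, fun z => (hrun z).trans (h7 z)⟩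

lemma splice_splice (n : ℕ) (w y : Seq) : splice n (splice n w y) w = w := by
  funext j
  by_cases h : j < n <;> simp [splice, h]

lemma splice_strong_zero_mem {n : ℕ} {w : Seq} (hw : w ∈ goldenX) :
    splice n w (strong 0) ∈ tile n := by
  refine ⟨fun j hj => ?_, fun j hj => ?_⟩
  · have := hw j
    simp only [splice, strong] at hj
    split_ifs at hj <;> simp_all
  · simp [splice, strong, not_lt.2 hj]

/-- The transformation of the golden mean shift computed by a machine in `f` steps. -/
def machineMap {n M : ℕ} (f : ℕ) (D : Machine n M) (w : goldenX) : Seq :=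
  exec D f (D.1 ⟨splice n w (strong 0), splice_strong_zero_mem w.2⟩) w

lemma exec_eq_runTo (s : ℕ → Letter) {R n M : ℕ} (hn : 2 ≤ n) {c : Fin 3 → Fin M → ℕ × Seq}
    {D : Machine n M} (hD : ∀ i m, ∀ q ∈ tile n, HasStrongPrefix (near n i) q →
      lastTime s R (near n i) (c i m) < R →
        Describes s R c (lastTime s R (near n i) (c i m) + 1) q
          (D.2 (i, m, q (n - 2), q (n - 1)))) {f t : ℕ} (hf : R < f + t) (ht : t ≤ R)
    {q : Seq} {T : Target n M} (hT : Describes s R c t q T) {z : Seq}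
    (hz : splice n q z ∈ goldenX) : exec D f T z = runTo s R t (splice n q z) := by
  induction f generalizing t q T z with
  | zero => omega
  | succ f ih =>
    obtain ⟨q', _ | ⟨i, m, x⟩⟩ := T
    · exact (hT.2.1 rfl z).symm
    · obtain ⟨h1, h2, h3, h4⟩ := hT.2.2 i m x rfl
      have hw := toggle_mem i (deep x) (hT.1 z hz)
      rw [h4 z]
      simp only [exec]
      set w := toggle i (deep x) (splice n q' z) with hwdef
      have hpre : HasStrongPrefix (near n i) w := toggle_hasStrongPrefix _ (near_mod hn i)
        ((hasStrongPrefix_splice (near_le n i) _ z).2 h1)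
      have key := hD i m _ (splice_strong_zero_mem hw)
        ((hasStrongPrefix_splice (near_le n i) _ _).2 hpre) h3
      rw [splice, splice, if_pos (by omega), if_pos (by omega)] at key
      rw [ih (by omega) (by omega) key (by rwa [splice_splice]), splice_splice]

lemma exists_coding {α : Type*} [Nonempty α] {M : ℕ} {A : Finset α} (h : A.card ≤ M) :
    ∃ c : Fin M → α, ∀ l ∈ A, ∃ m, c m = l := by
  refine ⟨fun m => if h : (m : ℕ) < A.card then A.equivFin.symm ⟨m, h⟩ else Classical.arbitrary α,
    fun l hl => ⟨⟨A.equivFin ⟨l, hl⟩, (Fin.is_lt _).trans_le h⟩, ?_⟩⟩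
  simp

lemma exists_describes_node (s : ℕ → Letter) {R n M : ℕ} (hn : 5 ≤ n)
    {c : Fin 3 → Fin M → ℕ × Seq}
    (hc : ∀ i, ∀ l ∈ endLabels s (near n i - 1) R, ∃ m, c i m = l)
    (k : Fin 3 × Fin M × Bool × Bool) : ∃ T : Target n M, ∀ q ∈ tile n,
      HasStrongPrefix (near n k.1) q → lastTime s R (near n k.1) (c k.1 k.2.1) < R →
      q (n - 2) = k.2.2.1 → q (n - 1) = k.2.2.2 →
      Describes s R c (lastTime s R (near n k.1) (c k.1 k.2.1) + 1) q T := by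
  obtain ⟨i, m, b, b'⟩ := k
  by_cases h : ∃ q ∈ tile n, HasStrongPrefix (near n i) q ∧
    lastTime s R (near n i) (c i m) < R ∧ q (n - 2) = b ∧ q (n - 1) = b'
  · obtain ⟨q, hq, hp, hlt, hb, hb'⟩ := h
    obtain ⟨T, hT⟩ := exists_describes s hn hc (Nat.succ_le_of_lt hlt) hq
    refine ⟨T, fun p hpn hpp _ hpb hpb' => ?_⟩
    have : p = q := by
      funext j
      have := le_near_add_two n i
      by_cases h1 : j < near n i
      · rw [hpp j h1, hp j h1]
      · by_cases h2 : n ≤ j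
        · rw [hpn.2 j h2, hq.2 j h2]
        · obtain rfl | rfl : j = n - 2 ∨ j = n - 1 := by omega
          · exact hpb.trans hb.symm
          · exact hpb'.trans hb'.symm
    rw [this]
    exact hT
  · exact ⟨(⟨strong 0, strong_mem_tile (by omega)⟩, none), fun q hq hp hlt hb hb' =>
      absurd ⟨q, hq, hp, hlt, hb, hb'⟩ h⟩

lemma exists_machineMap_eq (s : ℕ → Letter) {R n M : ℕ} (hn : 5 ≤ n)
    (hM : ∀ i, (endLabels s (near n i - 1) R).card ≤ M) :
    ∃ D : Machine n M, ∀ w : goldenX, machineMap (R + 1) D w = runTo s R 0 w := by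
  choose c hc using fun i => exists_coding (hM i)
  choose D₁ hD₁ using fun q : tile n =>
    exists_describes (M := M) s hn hc (Nat.zero_le R) q.2
  choose D₂ hD₂ using exists_describes_node s hn hc
  refine ⟨(D₁, D₂), fun w => ?_⟩
  have hw := splice_splice n w (strong 0)
  have := exec_eq_runTo s (show 2 ≤ n by omega) (c := c) (D := (D₁, D₂))
    (fun i m q hq hp hlt => hD₂ (i, m, q (n - 2), q (n - 1)) q hq hp hlt rfl rfl)
    (show R < R + 1 + 0 by omega) (Nat.zero_le R)
    (hD₁ ⟨splice n w (strong 0), splice_strong_zero_mem w.2⟩) (z := w)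
    (hw.symm ▸ w.2)
  rw [hw] at this
  exact this

lemma card_machine (n M : ℕ) : Nat.card (Machine n M) =
    ((tile n).ncard * (24 * M + 1)) ^ ((tile n).ncard + 12 * M) := by
  have h : Nat.card (Target n M) = (tile n).ncard * (24 * M + 1) := by
    rw [Nat.card_prod, Nat.card_coe_set_eq, Nat.card_eq_fintype_card, Fintype.card_option]
    simp
    left
    ring
  rw [Nat.card_prod, Nat.card_fun, Nat.card_fun, h, Nat.card_coe_set_eq, ← pow_add]
  congr 2
  simp
  ring

lemma hasStrongPrefix_mul_three (j : ℕ) (w : Seq) :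
    HasStrongPrefix (3 * j) w ↔ ∀ b < j, block010 w b := by
  constructor
  · intro h b hb
    refine ⟨?_, ?_, ?_⟩
    · rw [h _ (by omega), decide_eq_false_iff_not]
      omega
    · rw [h _ (by omega), decide_eq_true_iff]
      omega
    · rw [h _ (by omega), decide_eq_false_iff_not]
      omega
  · intro h k hk
    obtain ⟨h0, h1, h2⟩ := h (k / 3) (by omega)
    obtain hk3 | hk3 | hk3 : k = 3 * (k / 3) ∨ k = 3 * (k / 3) + 1 ∨ k = 3 * (k / 3) + 2 := by
      omega
    · rw [hk3, h0, eq_comm, decide_eq_false_iff_not]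
      omega
    · rw [hk3, h1, eq_comm, decide_eq_true_iff]
      omega
    · rw [hk3, h2, eq_comm, decide_eq_false_iff_not]
      omega

lemma switchable_mul_three {w : Seq} (hw : w ∈ goldenX) (j : ℕ) :
    Switchable (3 * j) w ↔ ¬ block010 w j ∧ ∀ b < j, block010 w b := by
  rw [Switchable, hasStrongPrefix_mul_three, and_comm]
  refine and_congr_left fun _ => ⟨fun h hb => ?_, fun h => ?_⟩
  · rw [hb.2.1] at h
    simp at h
  · by_contra h1
    rw [Bool.not_eq_false] at h1
    refine h ⟨?_, h1, ?_⟩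
    · have := hw (3 * j)
      simpa [h1] using this
    · have := hw (3 * j + 1)
      simpa [h1] using this

lemma gmStep_eq_toggle (r : ℕ) {w : Seq} (hw : w ∈ goldenX) :
    gmStep r w = toggle 0 (fun m => if m / 3 % 3 ≠ r then 1 else 0) w := by
  by_cases h : ∃ j, ¬ block010 w j
  · have hs : Switchable (3 * firstNon010 w) w := by
      refine (switchable_mul_three hw _).2 ⟨Nat.sInf_mem (s := {j | ¬ block010 w j}) h,
        fun b hb => ?_⟩
      by_contra hc
      exact Nat.notMem_of_lt_sInf hb hc
    rw [gmStep, if_pos h, toggle_of_switchable _ (by omega) hs,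
      show 3 * firstNon010 w / 3 = firstNon010 w by omega]
    split_ifs <;> simp_all
  · rw [gmStep, if_neg h, toggle_of_not]
    intro m hm hs
    rw [show m = 3 * (m / 3) by omega] at hs
    exact h ⟨_, ((switchable_mul_three hw _).1 hs).1⟩

lemma gmA0_eq_toggle {w : Seq} (hw : w ∈ goldenX) :
    gmA0 w = toggle 0 (fun m => if m / 3 = 0 then 1 else 0) w := by
  by_cases h : block010 w 0
  · rw [gmA0, if_pos h]
    rcases toggle_cases 0 (fun m => if m / 3 = 0 then 1 else 0) w with h1 | ⟨m, hm, hs, h1, -⟩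
    · exact h1.symm
    · rw [show m = 3 * (m / 3) by omega, switchable_mul_three hw] at hs
      have h0 : m / 3 = 0 := by simpa using h1
      rw [h0] at hs
      exact absurd h hs.1
  · have hs : Switchable (3 * 0) w :=
      (switchable_mul_three hw 0).2 ⟨h, fun b hb => absurd hb (Nat.not_lt_zero b)⟩
    rw [gmA0, if_neg h, toggle_of_switchable _ rfl hs]
    simp

lemma switchable_add (m k : ℕ) (w : Seq) : Switchable (m + k) w ↔
    (∀ j < k, w j = decide ((m + k - j) % 3 = 2)) ∧ Switchable m (shiftBy k w) := by
  constructor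
  · rintro ⟨h1, h2⟩
    refine ⟨fun j hj => h1 j (by omega), fun j hj => ?_, ?_⟩
    · rw [shiftBy, h1 _ (by omega)]
      congr 1
      apply propext
      omega
    · rw [shiftBy, ← h2]
      congr 1
      omega
  · rintro ⟨h1, h2, h3⟩
    refine ⟨fun j hj => ?_, ?_⟩
    · by_cases hjk : j < k
      · exact h1 j hjk
      · have := h2 (j - k) (by omega)
        rw [shiftBy, show j - k + k = j by omega] at this
        rw [this]
        congr 1
        apply propext
        omega
    · rw [← h3, shiftBy]
      congr 1
      omega

lemma shiftBy_mem {w : Seq} (hw : w ∈ goldenX) (k : ℕ) : shiftBy k w ∈ goldenX := by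
  intro j
  have := hw (j + k)
  rwa [shiftBy, shiftBy, show j + 1 + k = j + k + 1 by omega]

lemma toggle_shiftBy {k : ℕ} (hk : k < 3) {h : ℕ → ZMod 2} {w : Seq}
    (hw : ∀ j < k, w j = decide ((k - j) % 3 = 2)) :
    toggle k (fun m => h (m / 3)) w =
      fun n => if n < k then w n else toggle 0 (fun m => h (m / 3)) (shiftBy k w) (n - k) := by
  have hiff : ∀ m, m % 3 = 0 → (Switchable (m + k) w ↔ Switchable m (shiftBy k w)) := by
    intro m hm
    rw [switchable_add, and_iff_right_iff_imp]
    intro _ j hj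
    rw [hw j hj]
    congr 1
    apply propext
    omega
  by_cases hex : ∃ m, m % 3 = 0 ∧ Switchable m (shiftBy k w)
  · obtain ⟨m, hm, hs⟩ := hex
    rw [toggle_of_switchable _ hm hs, toggle_of_switchable _ (by omega) ((hiff m hm).2 hs),
      show (m + k) / 3 = m / 3 by omega]
    funext n
    by_cases hn : n < k
    · rw [if_pos hn]
      split_ifs
      · rw [flipAt, if_neg (by omega)]
      · rfl
    · rw [if_neg hn]
      have hnk : n - k + k = n := by omega
      split_ifs
      · simp only [flipAt, shiftBy, hnk]
        congr 1
        apply propext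
        omega
      · rw [shiftBy, hnk]
  · rw [toggle_of_not _ fun m hm hs => hex ⟨m, hm, hs⟩, toggle_of_not]
    · funext n
      split_ifs with hn
      · rfl
      · rw [shiftBy, show n - k + k = n by omega]
    · intro m hm hs
      obtain ⟨m', rfl⟩ : ∃ m', m = m' + k := ⟨m - k, by omega⟩
      exact hex ⟨m', by omega, (hiff m' (by omega)).1 hs⟩

lemma toggle_of_not_prefix {k : ℕ} (hk : k < 3) (o : ℕ → ZMod 2) {w : Seq}
    (hw : ¬ ∀ j < k, w j = decide ((k - j) % 3 = 2)) : toggle k o w = w := by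
  refine toggle_of_not _ fun m hm hs => hw fun j hj => ?_
  rw [hs.1 j (by omega)]
  congr 1
  apply propext
  omega

lemma lift1_eq_toggle {f : Seq → Seq} {h : ℕ → ZMod 2}
    (hf : ∀ w ∈ goldenX, f w = toggle 0 (fun m => h (m / 3)) w) {w : Seq} (hw : w ∈ goldenX) :
    lift1 f w = toggle 1 (fun m => h (m / 3)) w := by
  by_cases h0 : w 0 = false
  · rw [lift1, if_pos h0, toggle_shiftBy (by omega), hf _ (shiftBy_mem hw 1)]
    · funext n
      by_cases hn : n = 0
      · simp [hn]
      · rw [if_neg hn, if_neg (by omega)]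
    · intro j hj
      obtain rfl : j = 0 := by omega
      simpa using h0
  · rw [lift1, if_neg h0, toggle_of_not_prefix (by omega)]
    intro hc
    exact h0 (by simpa using hc 0 (by omega))

lemma lift2_eq_toggle {f : Seq → Seq} {h : ℕ → ZMod 2}
    (hf : ∀ w ∈ goldenX, f w = toggle 0 (fun m => h (m / 3)) w) {w : Seq} (hw : w ∈ goldenX) :
    lift2 f w = toggle 2 (fun m => h (m / 3)) w := by
  by_cases h0 : w 0 = false
  · rw [lift2, if_pos h0, toggle_of_not_prefix (by omega)]
    intro hc
    have := hc 0 (by omega)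
    simp [h0] at this
  · rw [lift2, if_neg h0, toggle_shiftBy (by omega), hf _ (shiftBy_mem hw 2)]
    have h1 := hw 0
    intro j hj
    obtain rfl | rfl : j = 0 ∨ j = 1 := by omega
    · simpa using h0
    · simpa [h0] using h1

/-- The letter given by a type and the action of `bᵢ`, `cᵢ` or `dᵢ`, according to `r`. -/
def stepLetter (i : Fin 3) (r : Fin 3) : Letter where
  ty := i
  ty_lt := i.2
  op := fun m => if m / 3 % 3 ≠ r then 1 else 0
  chi := fun k => if k ≠ r then 1 else 0
  op_eq := fun m _ => by simp [Fin.ext_iff]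
  chi_sum := by
    revert r
    decide

/-- The letter given by a type and the action of `aᵢ`. -/
def rootLetter (i : Fin 3) : Letter where
  ty := i
  ty_lt := i.2
  op := fun m => if m / 3 = 0 then 1 else 0
  chi := 0
  op_eq := fun m hm => by
    rw [if_neg (by omega)]
    rfl
  chi_sum := by decide

/-- The letter acting trivially. -/
def trivialLetter : Letter where
  ty := 0
  ty_lt := by omega
  op := 0
  chi := 0
  op_eq := fun _ _ => rfl
  chi_sum := by decide

lemma exists_letter {g : Seq → Seq} (hg : g ∈ gmGens) :
    ∃ L : Letter, ∀ w ∈ goldenX, g w = toggle L.ty L.op w := by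
  set hs : ℕ → ℕ → ZMod 2 := fun r j => if j % 3 ≠ r then 1 else 0
  set ha : ℕ → ZMod 2 := fun j => if j = 0 then 1 else 0
  have h0 : ∀ r, ∀ w ∈ goldenX, gmStep r w = toggle 0 (fun m => hs r (m / 3)) w :=
    fun r _ hw => gmStep_eq_toggle r hw
  have h1 : ∀ r, ∀ w ∈ goldenX, lift1 (gmStep r) w = toggle 1 (fun m => hs r (m / 3)) w :=
    fun r _ hw => lift1_eq_toggle (h0 r) hw
  have h2 : ∀ r, ∀ w ∈ goldenX, lift2 (gmStep r) w = toggle 2 (fun m => hs r (m / 3)) w :=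
    fun r _ hw => lift2_eq_toggle (h0 r) hw
  have a0 : ∀ w ∈ goldenX, gmA0 w = toggle 0 (fun m => ha (m / 3)) w :=
    fun _ hw => gmA0_eq_toggle hw
  have a1 : ∀ w ∈ goldenX, lift1 gmA0 w = toggle 1 (fun m => ha (m / 3)) w :=
    fun _ hw => lift1_eq_toggle a0 hw
  have a2 : ∀ w ∈ goldenX, lift2 gmA0 w = toggle 2 (fun m => ha (m / 3)) w :=
    fun _ hw => lift2_eq_toggle a0 hw
  rcases hg with rfl | rfl | rfl | rfl | rfl | rfl | rfl | rfl | rfl | rfl | rfl | rfl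
  · exact ⟨rootLetter 0, a0⟩
  · exact ⟨rootLetter 1, a1⟩
  · exact ⟨rootLetter 2, a2⟩
  · exact ⟨stepLetter 0 2, h0 2⟩
  · exact ⟨stepLetter 1 2, h1 2⟩
  · exact ⟨stepLetter 2 2, h2 2⟩
  · exact ⟨stepLetter 0 1, h0 1⟩
  · exact ⟨stepLetter 1 1, h1 1⟩
  · exact ⟨stepLetter 2 1, h2 1⟩
  · exact ⟨stepLetter 0 0, h0 0⟩
  · exact ⟨stepLetter 1 0, h1 0⟩
  · exact ⟨stepLetter 2 0, h2 0⟩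

lemma run_succ_time (s : ℕ → Letter) (d t : ℕ) (w : Seq) :
    run s d (t + 1) w = run (fun r => s (r + 1)) d t w := by
  induction d generalizing t w with
  | zero => rfl
  | succ d ih => rw [run, run, ih]

lemma comp_append (l : List (Seq → Seq)) (g : Seq → Seq) : comp (l ++ [g]) = comp l ∘ g := by
  induction l with
  | nil => rfl
  | cons f l ih =>
    change f ∘ comp (l ++ [g]) = (f ∘ comp l) ∘ g
    rw [ih]
    rfl

lemma exists_run_eq_comp (l : List (Seq → Seq)) (hl : ∀ g ∈ l, g ∈ gmGens) :
    ∃ s : ℕ → Letter, ∀ d, l.length ≤ d → ∀ w ∈ goldenX, run s d 0 w = comp l w := by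
  induction l using List.reverseRecOn with
  | nil =>
    refine ⟨fun _ => trivialLetter, fun d _ w _ => ?_⟩
    have : ∀ t, run (fun _ => trivialLetter) d t w = w := by
      induction d with
      | zero => exact fun _ => rfl
      | succ d ih =>
        intro t
        rw [run, show trivialLetter.op = 0 from rfl, toggle_zero_fun]
        exact ih (Nat.zero_le d) _
    exact this 0
  | append_singleton l g ih =>
    obtain ⟨s, hs⟩ := ih fun f hf => hl f (List.mem_append_left _ hf)
    obtain ⟨L, hL⟩ := exists_letter (hl g (by simp))
    refine ⟨fun t => if t = 0 then L else s (t - 1), fun d hd w hw => ?_⟩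
    rw [List.length_append, List.length_singleton] at hd
    obtain ⟨d, rfl⟩ : ∃ d', d = d' + 1 := ⟨d - 1, by omega⟩
    rw [comp_append, Function.comp_apply, hL w hw, run, run_succ_time]
    exact hs d (by omega) _ (toggle_mem _ _ hw)

lemma gmGrowth_le {R n M : ℕ} (hn : 5 ≤ n)
    (hM : ∀ (s : ℕ → Letter) i, (endLabels s (near n i - 1) R).card ≤ M) :
    gmGrowth R ≤ ((tile n).ncard * (24 * M + 1)) ^ ((tile n).ncard + 12 * M) := by
  rw [← card_machine, gmGrowth]
  have hsub : ((fun f : Seq → Seq => goldenX.domRestrict f) ''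
      {f | ∃ l : List (Seq → Seq), (∀ s ∈ l, s ∈ gmGens) ∧ l.length ≤ R ∧ comp l = f}) ⊆
      Set.range (machineMap (n := n) (M := M) (R + 1)) := by
    rintro _ ⟨_, ⟨l, hl, hlen, rfl⟩, rfl⟩
    obtain ⟨s, hs⟩ := exists_run_eq_comp l hl
    obtain ⟨D, hD⟩ := exists_machineMap_eq s hn (hM s)
    refine ⟨D, funext fun w => ?_⟩
    rw [hD, runTo, Nat.sub_zero, hs R hlen w w.2]
    rfl
  exact (Nat.card_mono (Set.finite_range _) hsub).trans (Finite.card_range_le _)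

lemma card_endLabels_near_le (s : ℕ → Letter) {R k : ℕ} (hR : R ≤ 70 ^ (k + 1)) (i : Fin 3) :
    (endLabels s (near (8 * k + 5) i - 1) R).card ≤ 109 * 47 ^ k := by
  obtain ⟨n, hn, hn5, he⟩ : ∃ n, 2 ≤ n ∧ n ≤ 5 ∧ near (8 * k + 5) i - 1 = n + 8 * k := by
    refine ⟨near (8 * k + 5) i - 1 - 8 * k, ?_, ?_, ?_⟩ <;> (unfold near; omega)
  rw [he]
  have h1 := card_endLabels_le s hn R k
  have h2 : ((tile (n + 8 * k)).ncard : ℝ) ≤ 13 * 47 ^ k := by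
    exact_mod_cast (ncard_tile_mono (show n + 8 * k ≤ 8 * k + 5 by omega)).trans
      ((ncard_tile_le _).trans (fib_le k))
  have h3 : (2 / 3 : ℝ) ^ k * R ≤ 70 * 47 ^ k := calc
    (2 / 3 : ℝ) ^ k * R ≤ (2 / 3) ^ k * 70 ^ (k + 1) := by
      gcongr
      exact_mod_cast hR
    _ = 70 * (2 / 3 * 70) ^ k := by
      rw [mul_pow, pow_succ]
      ring
    _ ≤ 70 * 47 ^ k := by
      gcongr
      norm_num
  have : ((endLabels s (n + 8 * k) R).card : ℝ) ≤ ((109 * 47 ^ k : ℕ) : ℝ) := by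
    push_cast
    linarith
  exact_mod_cast this

lemma gmGrowth_le_pow {R k : ℕ} (hR : R ≤ 70 ^ (k + 1)) :
    gmGrowth R ≤ (47 ^ (2 * k + 3)) ^ (1321 * 47 ^ k) := by
  have hq : (tile (8 * k + 5)).ncard ≤ 13 * 47 ^ k := (ncard_tile_le _).trans (fib_le k)
  have hp : 1 ≤ 47 ^ k := Nat.one_le_pow _ _ (by omega)
  refine (gmGrowth_le (show 5 ≤ 8 * k + 5 by omega)
    fun s i => card_endLabels_near_le s hR i).trans ?_
  have hbase : (tile (8 * k + 5)).ncard * (24 * (109 * 47 ^ k) + 1) ≤ 47 ^ (2 * k + 3) := calc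
    _ ≤ (13 * 47 ^ k) * (2617 * 47 ^ k) := Nat.mul_le_mul hq (by omega)
    _ = 34021 * 47 ^ (2 * k) := by ring
    _ ≤ 47 ^ 3 * 47 ^ (2 * k) := Nat.mul_le_mul_right _ (by norm_num)
    _ = 47 ^ (2 * k + 3) := by ring
  calc _ ≤ (47 ^ (2 * k + 3)) ^ ((tile (8 * k + 5)).ncard + 12 * (109 * 47 ^ k)) :=
        Nat.pow_le_pow_left hbase _
    _ ≤ _ := Nat.pow_le_pow_right (Nat.pow_pos (by omega)) (by omega)

lemma succ_mul_pow_le (k : ℕ) : ((k : ℝ) + 1) * 47 ^ k ≤ 47 * 48 ^ k := by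
  have h := one_add_mul_le_pow (show (-2 : ℝ) ≤ 1 / 47 by norm_num) k
  calc ((k : ℝ) + 1) * 47 ^ k ≤ 47 * (1 + k * (1 / 47)) * 47 ^ k := by
        gcongr
        linarith
    _ ≤ 47 * (1 + 1 / 47) ^ k * 47 ^ k := by gcongr
    _ = 47 * 48 ^ k := by
        rw [mul_assoc, ← mul_pow]
        norm_num

lemma gmGrowth_le_exp {R k : ℕ} (hR : R ≤ 70 ^ (k + 1)) :
    (gmGrowth R : ℝ) ≤ Real.exp (745044 * 48 ^ k) := by
  have h47 : (47 : ℝ) ≤ Real.exp 4 := by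
    have := Real.exp_one_gt_d9
    calc (47 : ℝ) ≤ 2.7 ^ 4 := by norm_num
      _ ≤ Real.exp 1 ^ 4 := by gcongr; linarith
      _ = Real.exp 4 := by rw [← Real.exp_nat_mul]; norm_num
  calc (gmGrowth R : ℝ) ≤ (47 ^ (2 * k + 3)) ^ (1321 * 47 ^ k) := by
        exact_mod_cast gmGrowth_le_pow hR
    _ ≤ (Real.exp 4 ^ (2 * k + 3)) ^ (1321 * 47 ^ k) := by gcongr
    _ = Real.exp (1321 * 47 ^ k * ((2 * k + 3) * 4)) := by
        rw [← Real.exp_nat_mul, ← Real.exp_nat_mul]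
        push_cast
        rfl
    _ ≤ Real.exp (745044 * 48 ^ k) := by
        rw [Real.exp_le_exp]
        have h1 := succ_mul_pow_le k
        have h2 : (0 : ℝ) ≤ k * 47 ^ k := by positivity
        linarith

lemma rpow_le_of_pow_le {R k : ℕ} (hR : 70 ^ k ≤ R) :
    (48 : ℝ) ^ k ≤ (R : ℝ) ^ (0.9181 : ℝ) := by
  have h48 : (48 : ℝ) ≤ 70 ^ (0.9181 : ℝ) := by
    calc (48 : ℝ) = ((48 : ℝ) ^ (12 : ℕ)) ^ (1 / 12 : ℝ) := by
          rw [← Real.rpow_natCast, ← Real.rpow_mul (by norm_num)]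
          norm_num
      _ ≤ ((70 : ℝ) ^ (11 : ℕ)) ^ (1 / 12 : ℝ) := by
          gcongr
          norm_num
      _ = 70 ^ (11 / 12 : ℝ) := by
          rw [← Real.rpow_natCast, ← Real.rpow_mul (by norm_num)]
          norm_num
      _ ≤ 70 ^ (0.9181 : ℝ) := Real.rpow_le_rpow_of_exponent_le (by norm_num) (by norm_num)
  calc (48 : ℝ) ^ k ≤ (70 ^ (0.9181 : ℝ)) ^ k := by gcongr
    _ = ((70 : ℝ) ^ k) ^ (0.9181 : ℝ) := by
        rw [← Real.rpow_natCast, ← Real.rpow_natCast, ← Real.rpow_mul (by norm_num),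
          ← Real.rpow_mul (by norm_num), mul_comm]
    _ ≤ (R : ℝ) ^ (0.9181 : ℝ) := by
        gcongr
        exact_mod_cast hR

/-- The growth of the group `Ĝ` generated by the twelve
transformations `{aᵢ, bᵢ, cᵢ, dᵢ}` of the golden mean shift satisfies
`γ_Ĝ(R) ≼ exp(R^{0.9181})`. -/
theorem goldenMean_growth_upper_bound :
    ∃ C : ℝ, 1 ≤ C ∧ ∀ R : ℕ, 1 ≤ R →
      (gmGrowth R : ℝ) ≤ Real.exp ((C * (R : ℝ)) ^ (0.9181 : ℝ)) := by
  refine ⟨745044 ^ (2 : ℝ), Real.one_le_rpow (by norm_num) (by norm_num), fun R hR => ?_⟩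
  have hC : (745044 : ℝ) ≤ (745044 ^ (2 : ℝ)) ^ (0.9181 : ℝ) := by
    rw [← Real.rpow_mul (by norm_num)]
    exact Real.self_le_rpow_of_one_le (by norm_num) (by norm_num)
  refine (gmGrowth_le_exp (Nat.lt_pow_succ_log_self (by norm_num : 1 < 70) R).le).trans ?_
  rw [Real.exp_le_exp, Real.mul_rpow (by positivity) (by positivity)]
  exact mul_le_mul hC (rpow_le_of_pow_le (Nat.pow_log_le_self 70 (by omega))) (by positivity)
    (by positivity)

end GoldenMean
end
end

section
/- Let Ĝ = ⟨a_0, a_1, b, c, d⟩ be the group of transformations of the space X of sequences over {0_0, 0_1, 1} (with allowed two-letter subwords {0_00_1, 0_10_0, 0_11, 10_0, 10_1, 11}) generated by the lift of the Grigorchuk generators b, c, d together with the two involutions a_0, a_1 splitting the lift of a. Let η ≈ 0.87176 be the unique positive real root of x⁴ + x³ + x² − 2. Then for every α > log 2 / (log 2 − log η) ≈ 0.83473 the growth of Ĝ satisfies γ_Ĝ(R) ≼ exp(R^α). -/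
noncomputable section
open scoped Classical

namespace SimpleGrig

/-- The alphabet `{0₀, 0₁, 1}`. -/
inductive GA : Type
  | z0 : GA  -- the letter `0₀`
  | z1 : GA  -- the letter `0₁`
  | one : GA -- the letter `1`
  deriving DecidableEq

/-- The allowed two-letter subwords
`{0₀0₁, 0₁0₀, 0₁1, 10₀, 10₁, 11}`. -/
def allowedPair : GA → GA → Prop
  | GA.z0, q => q = GA.z1
  | GA.z1, q => q ≠ GA.z1
  | GA.one, _ => True

/-- The space `X` of sequences over `{0₀, 0₁, 1}` in which every two-letter
subword is allowed. -/
def GX : Set (ℕ → GA) := {w | ∀ n : ℕ, allowedPair (w n) (w (n + 1))}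

/-- Shift a sequence by `k` letters. -/
def shiftBy (k : ℕ) (w : ℕ → GA) : ℕ → GA := fun n => w (n + k)

/-- The lift `a` of the Grigorchuk generator `a` to `X`:
`(0ₓw)·a = 1w`, `(10ₓw)·a = 0_{1−x}0ₓw`, `(11w)·a = 0₁1w`
(only the first letter changes). -/
def hatA (w : ℕ → GA) : ℕ → GA := fun n =>
  if n = 0 then
    (match w 0, w 1 with
      | GA.z0, _ => GA.one
      | GA.z1, _ => GA.one
      | GA.one, GA.z0 => GA.z1
      | GA.one, GA.z1 => GA.z0
      | GA.one, GA.one => GA.z1)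
  else w n

/-- The involution `a₀`: swaps `10₁w ↔ 0₀0₁w` and fixes all other sequences. -/
def hatA0 (w : ℕ → GA) : ℕ → GA := fun n =>
  if n = 0 then
    (match w 0, w 1 with
      | GA.one, GA.z1 => GA.z0
      | GA.z0, GA.z1 => GA.one
      | p, _ => p)
  else w n

/-- The involution `a₁`: swaps `1xw ↔ 0₁xw` for `x ∈ {0₀, 1}` and fixes all
other sequences. -/
def hatA1 (w : ℕ → GA) : ℕ → GA := fun n =>
  if n = 0 then
    (match w 0, w 1 with
      | GA.one, GA.z0 => GA.z1
      | GA.one, GA.one => GA.z1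
      | GA.z1, GA.z0 => GA.one
      | GA.z1, GA.one => GA.one
      | p, _ => p)
  else w n

/-- Given the (new) second letter of a sequence, the unique letter `0_δ` which may
precede it. -/
def headFix : GA → GA
  | GA.one => GA.z1
  | GA.z0 => GA.z1
  | GA.z1 => GA.z0

/-- The action of `b`, `c`, `d` on a sequence starting with a letter `0ₓ`:
the tail gets `a` applied, and the first letter becomes the unique `0_δ`
compatible with the new second letter.  This encodes the rules
`(0_{1−x}0ₓw)·b = 0₁(0ₓw·a)`, `(0₁10ₓw)·b = 0ₓ(10ₓw·a)`, `(0₁11w)·b = 0₀(11w·a)`. -/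
def zeroCase (w : ℕ → GA) : ℕ → GA := fun n =>
  if n = 0 then headFix (hatA (shiftBy 1 w) 0) else hatA (shiftBy 1 w) (n - 1)

/-- The position of the first letter of `w` different from `1`. -/
def firstNotOne (w : ℕ → GA) : ℕ := sInf {n | w n ≠ GA.one}

/-- The common pattern of the lifted generators `b`, `c`, `d`: if `w = 1^k 0ₓ …`,
then the suffix starting at position `k` undergoes `zeroCase` iff `k % 3 ≠ r`
(and sequences without any `0ₓ` are fixed).  For `r = 2` this is exactly the lift
of `b`, defined recursively by the `zeroCase` rules and `(1w)·b = 1(w·c)`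
(similarly `r = 1` for `c` and `r = 0` for `d`). -/
def hatStep (r : ℕ) (w : ℕ → GA) : ℕ → GA :=
  if ∃ n, w n ≠ GA.one then
    (if (firstNotOne w) % 3 ≠ r then
      (fun n => if n < firstNotOne w then w n
                else zeroCase (shiftBy (firstNotOne w) w) (n - firstNotOne w))
     else w)
  else w

/-- The lift of the Grigorchuk generator `b` to `X`. -/
def hatB : (ℕ → GA) → ℕ → GA := hatStep 2
/-- The lift of the Grigorchuk generator `c` to `X`. -/
def hatC : (ℕ → GA) → ℕ → GA := hatStep 1
/-- The lift of the Grigorchuk generator `d` to `X`. -/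
def hatD : (ℕ → GA) → ℕ → GA := hatStep 0


/-- The generating set `S = {a₀, a₁, b, c, d}` of `Ĝ`. -/
def hatGens : Set ((ℕ → GA) → ℕ → GA) := {hatA0, hatA1, hatB, hatC, hatD}

/-- The transformation given by a word in the generators. -/
def comp (l : List ((ℕ → GA) → ℕ → GA)) : (ℕ → GA) → ℕ → GA := l.foldr (· ∘ ·) id

/-- `γ_Ĝ(R)`: the number of distinct transformations of `X` representable as
products of at most `R` generators (all generators are involutions, so these are
exactly the elements of word length at most `R`). -/
def hatGrowth (R : ℕ) : ℕ :=
  Nat.card ((fun f : (ℕ → GA) → ℕ → GA => GX.restrict f) ''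
    {f | ∃ l : List ((ℕ → GA) → ℕ → GA),
      (∀ s ∈ l, s ∈ hatGens) ∧ l.length ≤ R ∧ comp l = f})

/-! ### Prepending a letter -/

/-- Prepend the letter `1` (for `true`) or the unique letter `0_δ` compatible with the
first letter of `v` (for `false`). -/
def cons (b : Bool) (v : ℕ → GA) : ℕ → GA
  | 0 => if b then GA.one else headFix (v 0)
  | n + 1 => v n

@[simp] lemma cons_zero (b : Bool) (v : ℕ → GA) :
    cons b v 0 = if b then GA.one else headFix (v 0) := rfl

@[simp] lemma cons_succ (b : Bool) (v : ℕ → GA) (n : ℕ) : cons b v (n + 1) = v n := rfl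

lemma headFix_ne_one (g : GA) : headFix g ≠ GA.one := by cases g <;> simp [headFix]

lemma cons_mem {v : ℕ → GA} (hv : v ∈ GX) (b : Bool) : cons b v ∈ GX := by
  intro n
  cases n with
  | zero =>
    rw [cons_succ, cons_zero]
    cases b <;> cases v 0 <;> simp [allowedPair, headFix]
  | succ n => exact hv n

lemma shiftBy_one_mem {w : ℕ → GA} (hw : w ∈ GX) : shiftBy 1 w ∈ GX := fun n => hw (n + 1)

/-- Whether the first letter is `1`. -/
def cl (u : ℕ → GA) : Bool := decide (u 0 = GA.one)

/-- Whether the first letter is `0₁`. -/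
def tp (u : ℕ → GA) : Bool := decide (u 0 = GA.z1)

@[simp] lemma cl_cons (b : Bool) (v : ℕ → GA) : cl (cons b v) = b := by
  cases b <;> simp [cl, headFix_ne_one]

@[simp] lemma tp_cons_true (v : ℕ → GA) : tp (cons true v) = false := by simp [tp]

@[simp] lemma tp_cons_false (v : ℕ → GA) : tp (cons false v) = !tp v := by
  cases h : v 0 <;> simp [tp, headFix, h]

lemma tp_of_cl {u : ℕ → GA} (h : cl u = true) : tp u = false := by
  simp only [cl, decide_eq_true_eq] at h
  simp [tp, h]

lemma cons_cl_shiftBy {w : ℕ → GA} (hw : w ∈ GX) : cons (cl w) (shiftBy 1 w) = w := by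
  funext n
  cases n with
  | zero =>
    have h := hw 0
    rw [cons_zero]
    cases h0 : w 0 <;> cases h1 : w 1 <;> simp_all [cl, shiftBy, headFix, allowedPair]
  | succ n => rfl

lemma exists_cons {w : ℕ → GA} (hw : w ∈ GX) : ∃ b, ∃ v ∈ GX, w = cons b v :=
  ⟨_, _, shiftBy_one_mem hw, (cons_cl_shiftBy hw).symm⟩

/-! ### The involutions in terms of `cons` -/

@[simp] lemma hatA_cons (b : Bool) (v : ℕ → GA) : hatA (cons b v) = cons (!b) v := by
  funext n
  cases n with
  | zero => cases b <;> cases h : v 0 <;> simp [hatA, cons, headFix, h]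
  | succ n => simp [hatA]

lemma hatA0_cons (b : Bool) (v : ℕ → GA) : hatA0 (cons b v) = cons (b ^^ tp v) v := by
  funext n
  cases n with
  | zero => cases b <;> cases h : v 0 <;> simp [hatA0, cons, headFix, h, tp]
  | succ n => simp [hatA0]

lemma hatA1_cons (b : Bool) (v : ℕ → GA) : hatA1 (cons b v) = cons (b ^^ !tp v) v := by
  funext n
  cases n with
  | zero => cases b <;> cases h : v 0 <;> simp [hatA1, cons, headFix, h, tp]
  | succ n => simp [hatA1]

lemma hatA_mem {u : ℕ → GA} (hu : u ∈ GX) : hatA u ∈ GX := by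
  obtain ⟨b, v, hv, rfl⟩ := exists_cons hu
  rw [hatA_cons]
  exact cons_mem hv _

lemma hatA_hatA {u : ℕ → GA} (hu : u ∈ GX) : hatA (hatA u) = u := by
  obtain ⟨b, v, hv, rfl⟩ := exists_cons hu
  simp

lemma cl_hatA {u : ℕ → GA} (hu : u ∈ GX) : cl (hatA u) = !cl u := by
  obtain ⟨b, v, hv, rfl⟩ := exists_cons hu
  simp

/-! ### The Klein four-group generated by `b`, `c`, `d` -/

/-- The Klein four-group, written additively: the element `(p, q)` is thought of as the
function on `ℤ/3` with values `p`, `q`, `p + q`. -/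
abbrev Letter := ZMod 2 × ZMod 2

/-- The value of a letter at `k mod 3`. -/
def chi (c : Letter) (k : ℕ) : ZMod 2 :=
  if k % 3 = 0 then c.1 else if k % 3 = 1 then c.2 else c.1 + c.2

/-- The rotation of letters: `b ↦ c ↦ d ↦ b`. -/
def rot (c : Letter) : Letter := (c.2, c.1 + c.2)

lemma chi_succ (c : Letter) (k : ℕ) : chi c (k + 1) = chi (rot c) k := by
  have h : k % 3 = 0 ∨ k % 3 = 1 ∨ k % 3 = 2 := by omega
  have h2 : ∀ p q : ZMod 2, p = q + (p + q) := by decide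
  rcases h with h | h | h <;> simp [chi, rot, Nat.add_mod, h]
  exact h2 _ _

/-- The transformation of sequences given by a letter. -/
def hatL (c : Letter) (w : ℕ → GA) : ℕ → GA :=
  if (∃ n, w n ≠ GA.one) ∧ chi c (firstNotOne w) ≠ 0 then
    (fun n => if n < firstNotOne w then w n
      else zeroCase (shiftBy (firstNotOne w) w) (n - firstNotOne w))
  else w

lemma hatStep_eq_hatL {r : ℕ} {c : Letter} (h : ∀ k, chi c k ≠ 0 ↔ k % 3 ≠ r) :
    hatStep r = hatL c := by
  funext w
  unfold hatStep hatL
  by_cases h1 : ∃ n, w n ≠ GA.one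
  · rw [if_pos h1]
    simp only [h, h1, true_and]
  · simp only [h1, false_and, if_false]

lemma hatB_eq : hatB = hatL (1, 1) := hatStep_eq_hatL fun k => by
  have : (1 + 1 : ZMod 2) = 0 := by decide
  have : k % 3 < 3 := Nat.mod_lt _ (by norm_num)
  unfold chi
  split_ifs <;> simp_all; omega

lemma hatC_eq : hatC = hatL (1, 0) := hatStep_eq_hatL fun k => by
  have : k % 3 < 3 := Nat.mod_lt _ (by norm_num)
  unfold chi
  split_ifs <;> simp_all

lemma hatD_eq : hatD = hatL (0, 1) := hatStep_eq_hatL fun k => by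
  have : k % 3 < 3 := Nat.mod_lt _ (by norm_num)
  unfold chi
  split_ifs <;> simp_all

lemma firstNotOne_cons_false (v : ℕ → GA) : firstNotOne (cons false v) = 0 :=
  Nat.sInf_eq_zero.2 (Or.inl (by simp [headFix_ne_one]))

lemma firstNotOne_cons_true {v : ℕ → GA} (hv : ∃ n, v n ≠ GA.one) :
    firstNotOne (cons true v) = firstNotOne v + 1 := by
  have h1 : v (firstNotOne v) ≠ GA.one := Nat.sInf_mem hv
  refine le_antisymm (Nat.sInf_le (by simpa using h1)) ?_
  have h2 : cons true v (firstNotOne (cons true v)) ≠ GA.one :=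
    Nat.sInf_mem (s := {n | cons true v n ≠ GA.one}) ⟨firstNotOne v + 1, by simpa using h1⟩
  cases h : firstNotOne (cons true v) with
  | zero => rw [h] at h2; simp at h2
  | succ k =>
    rw [h] at h2
    exact Nat.succ_le_succ (Nat.sInf_le (by simpa using h2))

lemma hatL_cons_false (c : Letter) (v : ℕ → GA) :
    hatL c (cons false v) = if c.1 ≠ 0 then cons false (hatA v) else cons false v := by
  have h : ∃ n, cons false v n ≠ GA.one := ⟨0, by simp [headFix_ne_one]⟩
  have h0 : chi c 0 = c.1 := by simp [chi]
  unfold hatL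
  simp only [h, true_and, firstNotOne_cons_false, h0]
  split_ifs
  · funext n
    cases n with
    | zero => simp [zeroCase, cons]; rfl
    | succ n => simp [zeroCase, cons]; rfl
  · rfl

lemma hatL_cons_true (c : Letter) (v : ℕ → GA) :
    hatL c (cons true v) = cons true (hatL (rot c) v) := by
  by_cases hv : ∃ n, v n ≠ GA.one
  · have h : ∃ n, cons true v n ≠ GA.one := hv.imp' Nat.succ fun n hn => by simpa using hn
    unfold hatL
    simp only [h, hv, true_and, firstNotOne_cons_true hv, chi_succ]
    split_ifs
    · funext n
      cases n with
      | zero => simp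
      | succ n =>
        simp only [cons_succ, Nat.add_lt_add_iff_right, Nat.add_sub_add_right]
        congr 1
    · rfl
  · have h : ¬ ∃ n, cons true v n ≠ GA.one := by
      rintro ⟨n, hn⟩
      cases n with
      | zero => simp at hn
      | succ n => exact hv ⟨n, hn⟩
    unfold hatL
    simp only [h, hv, false_and, if_false]

lemma hatL_ones (c : Letter) : hatL c (fun _ => GA.one) = fun _ => GA.one := by
  simp [hatL]

lemma GX_induction {Q : (ℕ → GA) → Prop} (ones : Q fun _ => GA.one)
    (hfalse : ∀ v ∈ GX, Q (cons false v)) (htrue : ∀ v ∈ GX, Q v → Q (cons true v)) :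
    ∀ w ∈ GX, Q w := by
  have key : ∀ k : ℕ, ∀ w ∈ GX, w k ≠ GA.one → Q w := by
    intro k
    induction k with
    | zero =>
      intro w hw hk
      obtain ⟨b, v, hv, rfl⟩ := exists_cons hw
      cases b
      · exact hfalse v hv
      · simp at hk
    | succ k ih =>
      intro w hw hk
      obtain ⟨b, v, hv, rfl⟩ := exists_cons hw
      cases b
      · exact hfalse v hv
      · exact htrue v hv (ih v hv (by simpa using hk))
  intro w hw
  by_cases h : ∃ k, w k ≠ GA.one
  · exact key h.choose w hw h.choose_spec
  · push Not at h
    rwa [show w = fun _ => GA.one from funext h]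

lemma hatL_mem (c : Letter) {w : ℕ → GA} (hw : w ∈ GX) : hatL c w ∈ GX := by
  refine GX_induction (Q := fun w => ∀ c, hatL c w ∈ GX) ?_ ?_ ?_ w hw c
  · intro c
    rw [hatL_ones]
    exact fun n => trivial
  · intro v hv c
    rw [hatL_cons_false]
    split_ifs
    · exact cons_mem (hatA_mem hv) _
    · exact cons_mem hv _
  · intro v hv ih c
    rw [hatL_cons_true]
    exact cons_mem (ih _) _

lemma hatL_add (c e : Letter) {w : ℕ → GA} (hw : w ∈ GX) :
    hatL (c + e) w = hatL e (hatL c w) := by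
  refine GX_induction (Q := fun w => ∀ c e, hatL (c + e) w = hatL e (hatL c w)) ?_ ?_ ?_ w hw c e
  · intro c e
    simp only [hatL_ones]
  · intro v hv c e
    have h2 : ∀ p q : ZMod 2, p ≠ 0 → q ≠ 0 → p + q = 0 := by decide
    by_cases hc : c.1 = 0 <;> by_cases he : e.1 = 0
    · simp [hatL_cons_false, hc, he]
    · simp [hatL_cons_false, hc, he]
    · simp [hatL_cons_false, hc, he]
    · simp [hatL_cons_false, hc, he, h2 _ _ hc he, hatA_hatA hv]
  · intro v hv ih c e
    have h : rot (c + e) = rot c + rot e := by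
      simp only [rot, Prod.fst_add, Prod.snd_add, Prod.mk_add_mk]
      congr 1
      ring
    rw [hatL_cons_true, hatL_cons_true, hatL_cons_true, h, ih]

lemma hatL_zero {w : ℕ → GA} : hatL 0 w = w := by
  simp [hatL, chi]

lemma cl_hatL (c : Letter) {u : ℕ → GA} (hu : u ∈ GX) : cl (hatL c u) = cl u := by
  obtain ⟨b, v, hv, rfl⟩ := exists_cons hu
  cases b
  · rw [hatL_cons_false]
    split_ifs <;> simp
  · simp [hatL_cons_true]

/-! ### First return maps -/

/-- `Hit p Y wt z s y`: following `p` from `z`, the first element satisfying `Y` is `y`, and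
`s` is the sum of the weights of the elements visited before it. -/
inductive Hit {Z A : Type*} [AddCommMonoid A] (p : Z → Z) (Y : Z → Prop) (wt : Z → A) :
    Z → A → Z → Prop
  | here {z : Z} : Y z → Hit p Y wt z 0 z
  | step {z : Z} {s : A} {y : Z} : ¬ Y z → Hit p Y wt (p z) s y → Hit p Y wt z (wt z + s) y

section Return

variable {Z A : Type*} [AddCommMonoid A]

lemma Hit.unique {p : Z → Z} {Y : Z → Prop} {wt : Z → A} {z : Z} {s : A} {y : Z}
    (h : Hit p Y wt z s y) {s' : A} {y' : Z} (h' : Hit p Y wt z s' y') : s = s' ∧ y = y' := by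
  induction h generalizing s' with
  | here hz =>
    cases h' with
    | here _ => exact ⟨rfl, rfl⟩
    | step hn _ => exact absurd hz hn
  | step hn _ ih =>
    cases h' with
    | here hz => exact absurd hz hn
    | step _ h2 =>
      obtain ⟨rfl, rfl⟩ := ih h2
      exact ⟨rfl, rfl⟩

lemma hit_of_pow (p : Equiv.Perm Z) {Y : Z → Prop} (wt : Z → A) (m : ℕ) (z : Z)
    (h : ∀ i < m, ¬ Y ((p ^ i) z)) (hm : Y ((p ^ m) z)) :
    Hit p Y wt z (∑ i ∈ Finset.range m, wt ((p ^ i) z)) ((p ^ m) z) := by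
  induction m generalizing z with
  | zero => exact Hit.here (by simpa using hm)
  | succ m ih =>
    have hp : ∀ i, (p ^ (i + 1)) z = (p ^ i) (p z) := fun i => by
      rw [pow_succ, Equiv.Perm.mul_apply]
    rw [Finset.sum_range_succ', add_comm]
    simp only [hp] at hm ⊢
    refine Hit.step (h 0 (Nat.succ_pos _)) (ih (p z) (fun i hi => ?_) hm)
    rw [← hp]
    exact h (i + 1) (Nat.succ_lt_succ hi)

lemma apply_sum_range_le_of_subadditive {c : A → ℝ} (hc : ∀ a b, c (a + b) ≤ c a + c b)
    (f : ℕ → A) (m : ℕ) :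
    c (∑ i ∈ Finset.range (m + 1), f i) ≤ ∑ i ∈ Finset.range (m + 1), c (f i) := by
  induction m with
  | zero => simp
  | succ m ih =>
    rw [Finset.sum_range_succ, Finset.sum_range_succ _ (m + 1)]
    exact (hc _ _).trans (add_le_add_left ih _)

theorem exists_return [Fintype Z] (p : Equiv.Perm Z) (Y : Z → Prop) (wt : Z → A) :
    ∃ (r : Equiv.Perm {z // Y z}) (s : {z // Y z} → A),
      (∀ y : {z // Y z}, Hit p Y wt (p y) (s y) (r y)) ∧
      ∀ c : A → ℝ, (∀ a, 0 ≤ c a) → (∀ a b, c (a + b) ≤ c a + c b) →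
        ∑ y : {z // Y z}, c (wt y + s y) ≤ ∑ z, c (wt z) := by
  have hex : ∀ y : {z // Y z}, ∃ k, Y ((p ^ (k + 1)) y) := fun y =>
    ⟨orderOf p - 1, by
      rw [Nat.sub_add_cancel (orderOf_pos p), pow_orderOf_eq_one]
      exact y.2⟩
  let k : {z // Y z} → ℕ := fun y => Nat.find (hex y)
  have hk : ∀ y, Y ((p ^ (k y + 1)) y) := fun y => Nat.find_spec (hex y)
  have hmin : ∀ y, ∀ i < k y, ¬ Y ((p ^ (i + 1)) y) := fun y i hi => Nat.find_min (hex y) hi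
  have inj1 : ∀ y y' : {z // Y z}, ∀ i j : ℕ, i ≤ j → j ≤ k y' + i →
      (p ^ i) y.1 = (p ^ j) y'.1 → y = y' ∧ i = j := by
    intro y y' i j hij hj h
    obtain ⟨d, rfl⟩ := Nat.exists_eq_add_of_le hij
    rw [pow_add, Equiv.Perm.mul_apply] at h
    have h := (p ^ i).injective h
    cases d with
    | zero => exact ⟨Subtype.ext (by simpa using h), rfl⟩
    | succ d => exact absurd (h ▸ y.2) (hmin y' d (by omega))
  have inj2 : ∀ y y' : {z // Y z}, ∀ i j : ℕ, j ≤ k y' + i → i ≤ k y + j →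
      (p ^ i) y.1 = (p ^ j) y'.1 → y = y' ∧ i = j := by
    intro y y' i j hj hi h
    rcases le_total i j with hij | hij
    · exact inj1 y y' i j hij hj h
    · obtain ⟨h1, h2⟩ := inj1 y' y j i hij hi h.symm
      exact ⟨h1.symm, h2.symm⟩
  let r0 : {z // Y z} → {z // Y z} := fun y => ⟨(p ^ (k y + 1)) y, hk y⟩
  have hr0 : Function.Injective r0 := fun y y' h =>
    (inj2 y y' (k y + 1) (k y' + 1) (by omega) (by omega) (congrArg Subtype.val h)).1
  have hp : ∀ (z : Z) (i : ℕ), (p ^ i) (p z) = (p ^ (i + 1)) z := fun z i => by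
    rw [pow_succ, Equiv.Perm.mul_apply]
  refine ⟨Equiv.ofBijective r0 (Finite.injective_iff_bijective.1 hr0),
    fun y => ∑ i ∈ Finset.range (k y), wt ((p ^ i) (p y)), fun y => ?_, fun c hc0 hc => ?_⟩
  · have := hit_of_pow p (Y := Y) wt (k y) (p y) (fun i hi => by rw [hp]; exact hmin y i hi)
      (by rw [hp]; exact hk y)
    rwa [hp] at this
  · calc ∑ y : {z // Y z}, c (wt y + ∑ i ∈ Finset.range (k y), wt ((p ^ i) (p y)))
        = ∑ y : {z // Y z}, c (∑ i ∈ Finset.range (k y + 1), wt ((p ^ i) y)) := by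
          refine Finset.sum_congr rfl fun y _ => ?_
          rw [Finset.sum_range_succ', add_comm]
          simp only [hp, pow_zero, Equiv.Perm.one_apply]
      _ ≤ ∑ y : {z // Y z}, ∑ i ∈ Finset.range (k y + 1), c (wt ((p ^ i) y)) :=
          Finset.sum_le_sum fun y _ => apply_sum_range_le_of_subadditive hc _ _
      _ = ∑ q ∈ Finset.univ.sigma fun y : {z // Y z} => Finset.range (k y + 1),
            c (wt ((p ^ q.2) q.1)) := Finset.sum_sigma' _ _ _
      _ = ∑ z ∈ (Finset.univ.sigma fun y : {z // Y z} => Finset.range (k y + 1)).image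
            (fun q => (p ^ q.2) q.1), c (wt z) := by
          rw [Finset.sum_image]
          rintro ⟨y, i⟩ hi ⟨y', j⟩ hj h
          simp only [Finset.coe_sigma, Set.mem_sigma_iff, Finset.coe_univ, Set.mem_univ,
            true_and, Finset.coe_range, Set.mem_Iio] at hi hj
          obtain ⟨rfl, rfl⟩ := inj2 y y' i j (by omega) (by omega) h
          rfl
      _ ≤ ∑ z, c (wt z) :=
          Finset.sum_le_sum_of_subset_of_nonneg (Finset.subset_univ _) fun _ _ _ => hc0 _

end Return

theorem exists_return_of_injective {Z N A : Type*} [AddCommMonoid A] [Fintype Z] [Fintype N]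
    (p : Equiv.Perm Z) {j : N → Z} (hj : Function.Injective j) (wt : Z → A) :
    ∃ (r : Equiv.Perm N) (s : N → A),
      (∀ n, Hit p (· ∈ Set.range j) wt (p (j n)) (s n) (j (r n))) ∧
      ∀ c : A → ℝ, (∀ a, 0 ≤ c a) → (∀ a b, c (a + b) ≤ c a + c b) →
        ∑ n, c (wt (j n) + s n) ≤ ∑ z, c (wt z) := by
  obtain ⟨r, s, h1, h2⟩ := exists_return p (· ∈ Set.range j) wt
  let e : N ≃ {z // z ∈ Set.range j} := Equiv.ofInjective j hj
  have he : ∀ n, (e n : Z) = j n := fun n => rfl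
  refine ⟨e.symm.permCongr r, fun n => s (e n), fun n => ?_, fun c hc0 hc => ?_⟩
  · have h3 := h1 (e n)
    rwa [he, ← e.apply_symm_apply (r (e n)), he] at h3
  · refine le_trans (le_of_eq ?_) (h2 c hc0 hc)
    convert Fintype.sum_equiv e (fun n => c (wt (j n) + s (e n))) (fun y => c (wt y + s y))
      fun n => rfl

/-! ### Machines -/

/-- A machine describes a transformation of sequences, where a sequence is presented as an
initial segment, recorded by an element of `I`, followed by a tail `u`.  The class of a tail
is `cl u`.  A computation jumps between *halts* (elements of `I`) and *events*; an event of
`L κ` applies a letter to a tail of class `κ`, an event of `P` applies `a` to the tail.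
The permutation `f κ τ` gives the jumps when the tail has class `κ` and type `τ`. -/
structure Mach (I : Type) where
  /-- The events applying a letter to tails of the given class. -/
  L : Bool → Type
  /-- The events applying `a`. -/
  P : Type
  /-- There are finitely many events applying letters. -/
  finL : ∀ κ, Fintype (L κ)
  /-- There are finitely many events applying `a`. -/
  finP : Fintype P
  /-- The letter applied at an event. -/
  lab : ∀ κ, L κ → Letter
  /-- The jumps. -/
  f : ∀ κ : Bool, Bool → Equiv.Perm (I ⊕ (L κ ⊕ P))

attribute [instance] Mach.finL Mach.finP

namespace Mach

variable {I : Type}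

/-- `M.Arr κ z u x u'`: the computation of `M` which arrives at `z` with a tail `u` of class
`κ` stops at the halt `x` with the tail `u'`. -/
inductive Arr (M : Mach I) :
    (κ : Bool) → I ⊕ (M.L κ ⊕ M.P) → (ℕ → GA) → I → (ℕ → GA) → Prop
  | halt (κ : Bool) (x : I) (u : ℕ → GA) : Arr M κ (Sum.inl x) u x u
  | left (κ : Bool) (l : M.L κ) (u : ℕ → GA) (x : I) (u' : ℕ → GA) :
      Arr M κ (M.f κ (tp (hatL (M.lab κ l) u)) (Sum.inr (Sum.inl l)))
        (hatL (M.lab κ l) u) x u' →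
      Arr M κ (Sum.inr (Sum.inl l)) u x u'
  | right (κ : Bool) (r : M.P) (u : ℕ → GA) (x : I) (u' : ℕ → GA) :
      Arr M (!κ) (M.f (!κ) (tp (hatA u)) (Sum.inr (Sum.inr r))) (hatA u) x u' →
      Arr M κ (Sum.inr (Sum.inr r)) u x u'

lemma Arr.unique {M : Mach I} {κ : Bool} {z : I ⊕ (M.L κ ⊕ M.P)} {u : ℕ → GA} {x : I}
    {u' : ℕ → GA} (h : M.Arr κ z u x u') {x2 : I} {u2 : ℕ → GA} (h2 : M.Arr κ z u x2 u2) :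
    x = x2 ∧ u' = u2 := by
  induction h with
  | halt κ x u => cases h2; exact ⟨rfl, rfl⟩
  | left κ l u x u' _ ih =>
    cases h2 with
    | left _ _ _ _ _ h2 => exact ih h2
  | right κ r u x u' _ ih =>
    cases h2 with
    | right _ _ _ _ _ h2 => exact ih h2

/-- The machine `M` computes the transformation `g`, with initial segments prepended by `ins`. -/
def Computes (M : Mach I) (ins : I → (ℕ → GA) → ℕ → GA) (g : (ℕ → GA) → ℕ → GA) : Prop :=
  ∀ x, ∀ u ∈ GX, ∃ x', ∃ u' ∈ GX,
    M.Arr (cl u) (M.f (cl u) (tp u) (Sum.inl x)) u x' u' ∧ g (ins x u) = ins x' u'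

lemma Computes.eq_of_computes {M : Mach I} {ins : I → (ℕ → GA) → ℕ → GA}
    {g g' : (ℕ → GA) → ℕ → GA} (h : M.Computes ins g) (h' : M.Computes ins g') {x : I}
    {u : ℕ → GA} (hu : u ∈ GX) : g (ins x u) = g' (ins x u) := by
  obtain ⟨x1, u1, -, h1, e1⟩ := h x u hu
  obtain ⟨x2, u2, -, h2, e2⟩ := h' x u hu
  obtain ⟨rfl, rfl⟩ := h1.unique h2
  rw [e1, e2]

/-! ### Extending machines -/

/-- The embedding of halts and events induced by embeddings of events. -/
def sumEmb {A A' B B' : Type} (i : A ↪ A') (k : B ↪ B') : I ⊕ (A ⊕ B) ↪ I ⊕ (A' ⊕ B') :=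
  (Function.Embedding.refl I).sumMap (i.sumMap k)

/-- Enlarge the sets of events, and compose the jumps with the permutations `π`. -/
def extend (M : Mach I) {L' : Bool → Type} {P' : Type} [finL : ∀ κ, Fintype (L' κ)]
    [finP : Fintype P'] (iL : ∀ κ, M.L κ ↪ L' κ) (iP : M.P ↪ P') (lab : ∀ κ, L' κ → Letter)
    (π : ∀ κ : Bool, Bool → Equiv.Perm (I ⊕ (L' κ ⊕ P'))) : Mach I where
  L := L'
  P := P'
  finL := finL
  finP := finP
  lab := lab
  f κ τ := ((M.f κ τ).viaEmbedding (sumEmb (iL κ) iP)).trans (π κ τ)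

section Extend

variable {M : Mach I} {L' : Bool → Type} {P' : Type} [∀ κ, Fintype (L' κ)] [Fintype P']
  {iL : ∀ κ, M.L κ ↪ L' κ} {iP : M.P ↪ P'} {lab : ∀ κ, L' κ → Letter}
  {π : ∀ κ : Bool, Bool → Equiv.Perm (I ⊕ (L' κ ⊕ P'))}

lemma extend_f_apply (κ τ : Bool) (z : I ⊕ (M.L κ ⊕ M.P)) :
    (M.extend iL iP lab π).f κ τ (sumEmb (iL κ) iP z) =
      π κ τ (sumEmb (iL κ) iP (M.f κ τ z)) :=
  congrArg (π κ τ) (Equiv.Perm.viaEmbedding_apply _ _ _)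

lemma Arr.extend (hlab : ∀ κ l, lab κ (iL κ l) = M.lab κ l)
    (hπ : ∀ κ τ z, π κ τ (sumEmb (iL κ) iP (Sum.inr z)) = sumEmb (iL κ) iP (Sum.inr z))
    {κ : Bool} {z : I ⊕ (M.L κ ⊕ M.P)} {u : ℕ → GA} {x : I} {u' : ℕ → GA}
    (h : M.Arr κ z u x u') (hu : u ∈ GX) (hκ : cl u = κ) {x2 : I} {u2 : ℕ → GA}
    (h2 : (M.extend iL iP lab π).Arr (cl u') (π (cl u') (tp u') (Sum.inl x)) u' x2 u2) :
    (M.extend iL iP lab π).Arr κ (π κ (tp u) (sumEmb (iL κ) iP z)) u x2 u2 := by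
  induction h with
  | halt κ x u => subst hκ; exact h2
  | left κ l u x u' _ ih =>
    rw [hπ]
    refine Arr.left (M := M.extend iL iP lab π) κ (iL κ l) u x2 u2 ?_
    have := ih (hatL_mem _ hu) (by rw [cl_hatL _ hu, hκ]) h2
    rw [← extend_f_apply (lab := lab) (π := π)] at this
    change (M.extend iL iP lab π).Arr κ
      ((M.extend iL iP lab π).f κ (tp (hatL (lab κ (iL κ l)) u)) (Sum.inr (Sum.inl (iL κ l))))
      (hatL (lab κ (iL κ l)) u) x2 u2
    rw [hlab]
    exact this
  | right κ r u x u' _ ih =>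
    rw [hπ]
    refine Arr.right (M := M.extend iL iP lab π) κ (iP r) u x2 u2 ?_
    have := ih (hatA_mem hu) (by rw [cl_hatA hu, hκ]) h2
    rw [← extend_f_apply (lab := lab) (π := π)] at this
    exact this

lemma Computes.extend {ins : I → (ℕ → GA) → ℕ → GA} {g g' : (ℕ → GA) → ℕ → GA}
    (h : M.Computes ins g) (hlab : ∀ κ l, lab κ (iL κ l) = M.lab κ l)
    (hπ : ∀ κ τ z, π κ τ (sumEmb (iL κ) iP (Sum.inr z)) = sumEmb (iL κ) iP (Sum.inr z))
    (hg : ∀ x, ∀ u ∈ GX, ∃ x2, ∃ u2 ∈ GX,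
      (M.extend iL iP lab π).Arr (cl u) (π (cl u) (tp u) (Sum.inl x)) u x2 u2 ∧
        g' (ins x u) = ins x2 u2) :
    (M.extend iL iP lab π).Computes ins (g' ∘ g) := by
  intro x u hu
  obtain ⟨x1, u1, hu1, h1, e1⟩ := h x u hu
  obtain ⟨x2, u2, hu2, h2, e2⟩ := hg x1 u1 hu1
  refine ⟨x2, u2, hu2, ?_, by rw [Function.comp_apply, e1, e2]⟩
  have := h1.extend hlab hπ hu rfl h2
  rw [← extend_f_apply (lab := lab) (π := π)] at this
  exact this

end Extend

end Mach

/-! ### The potential -/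

/-- The indicator of a nonzero element. -/
def ind (a : ZMod 2) : ℝ := if a = 0 then 0 else 1

lemma ind_nonneg (a : ZMod 2) : 0 ≤ ind a := by unfold ind; split_ifs <;> norm_num

lemma ind_le_one (a : ZMod 2) : ind a ≤ 1 := by unfold ind; split_ifs <;> norm_num

lemma ind_add_le (a b : ZMod 2) : ind (a + b) ≤ ind a + ind b := by
  by_cases ha : a = 0
  · simp [ha, ind]
  · have : ind a = 1 := by simp [ind, ha]
    linarith [ind_le_one (a + b), ind_nonneg b]

/-- The weight of an event applying the letter `c` to tails starting with `1`. -/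
def wtOne (η : ℝ) (c : Letter) : ℝ := (η + η ^ 2) * ind c.2 + η * ind (c.1 + c.2)

/-- The weight of an event applying the letter `c` to tails starting with `0₀` or `0₁`. -/
def wtZero (η : ℝ) (c : Letter) : ℝ := 2 / η * ind c.1

lemma wtOne_nonneg {η : ℝ} (hη : 0 < η) (c : Letter) : 0 ≤ wtOne η c := by
  have := ind_nonneg c.2
  have := ind_nonneg (c.1 + c.2)
  unfold wtOne
  positivity

lemma wtZero_nonneg {η : ℝ} (hη : 0 < η) (c : Letter) : 0 ≤ wtZero η c := by
  have := ind_nonneg c.1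
  unfold wtZero
  positivity

lemma wtOne_add_le {η : ℝ} (hη : 0 < η) (c e : Letter) :
    wtOne η (c + e) ≤ wtOne η c + wtOne η e := by
  have h1 := mul_le_mul_of_nonneg_left (ind_add_le c.2 e.2) (by positivity : 0 ≤ η + η ^ 2)
  have h2 := mul_le_mul_of_nonneg_left (ind_add_le (c.1 + c.2) (e.1 + e.2)) hη.le
  rw [add_add_add_comm c.1] at h2
  unfold wtOne
  rw [Prod.fst_add, Prod.snd_add]
  linarith

lemma wtOne_zero (η : ℝ) : wtOne η 0 = 0 := by simp [wtOne, ind]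

lemma wtOne_le {η : ℝ} (hη : 0 < η) (c : Letter) : wtOne η c ≤ η + η ^ 2 + η := by
  have h1 := mul_le_mul_of_nonneg_left (ind_le_one c.2) (by positivity : 0 ≤ η + η ^ 2)
  have h2 := mul_le_mul_of_nonneg_left (ind_le_one (c.1 + c.2)) hη.le
  unfold wtOne
  linarith

lemma wtZero_le {η : ℝ} (hη : 0 < η) (c : Letter) : wtZero η c ≤ 2 / η := by
  have h1 := mul_le_mul_of_nonneg_left (ind_le_one c.1) (by positivity : 0 ≤ 2 / η)
  unfold wtZero
  linarith

namespace Mach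

variable {I : Type}

/-- The potential of a machine: a weighted count of its events. -/
def potential (η : ℝ) (M : Mach I) : ℝ :=
  ∑ l, wtOne η (M.lab true l) + ∑ l, wtZero η (M.lab false l) + 2 * Fintype.card M.P

lemma two_mul_card_le_potential {η : ℝ} (hη : 0 < η) (M : Mach I) :
    2 * (Fintype.card M.P : ℝ) ≤ M.potential η := by
  have h1 : 0 ≤ ∑ l, wtOne η (M.lab true l) := Finset.sum_nonneg fun l _ => wtOne_nonneg hη _
  have h2 : 0 ≤ ∑ l, wtZero η (M.lab false l) := Finset.sum_nonneg fun l _ => wtZero_nonneg hη _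
  unfold potential
  linarith

end Mach

/-! ### Machines for words in the generators -/

/-- The growth of the potential when a generator is appended. -/
def stepCost (η : ℝ) : ℝ := η + η ^ 2 + η + 2 / η + 2

lemma stepCost_pos {η : ℝ} (hη : 0 < η) : 0 < stepCost η := by
  unfold stepCost
  positivity

lemma exists_mach_halts (η : ℝ) {M : Mach Bool} {g g' : (ℕ → GA) → ℕ → GA}
    (h : M.Computes cons g) (σ : Bool → Equiv.Perm Bool)
    (hg : ∀ b v, g' (cons b v) = cons (σ (tp v) b) v) :
    ∃ M' : Mach Bool, M'.Computes cons (g' ∘ g) ∧ M'.potential η = M.potential η := by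
  have hlab : ∀ κ l, M.lab κ (Function.Embedding.refl _ l) = M.lab κ l := fun _ _ => rfl
  refine ⟨M.extend (fun _ => Function.Embedding.refl _) (Function.Embedding.refl _) M.lab
    fun _ τ => Equiv.sumCongr (σ τ) (Equiv.refl _), h.extend hlab (fun κ τ z => ?_)
      fun b v hv => ⟨σ (tp v) b, v, hv, Mach.Arr.halt _ _ _, hg b v⟩, rfl⟩
  rcases z with z | z <;> rfl

lemma exists_mach_letter {η : ℝ} (hη : 0 < η) {M : Mach Bool} {g : (ℕ → GA) → ℕ → GA}
    (h : M.Computes cons g) (c : Letter) :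
    ∃ M' : Mach Bool, M'.Computes cons (hatL c ∘ g) ∧
      M'.potential η ≤ M.potential η + stepCost η := by
  let L' : Bool → Type := fun κ => Option (M.L κ)
  let lab' : ∀ κ, L' κ → Letter := fun κ o => o.elim (rot c) (M.lab κ)
  let π : ∀ κ : Bool, Bool → Equiv.Perm (Bool ⊕ (L' κ ⊕ Option M.P)) := fun κ _ =>
    Equiv.swap (Sum.inl true) (Sum.inr (Sum.inl none)) *
      if c.1 ≠ 0 then Equiv.swap (Sum.inl false) (Sum.inr (Sum.inr none)) else 1
  let M' := M.extend (fun κ => (Function.Embedding.some : M.L κ ↪ L' κ))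
    Function.Embedding.some lab' π
  have hπL : ∀ κ τ, π κ τ (Sum.inr (Sum.inl none)) = Sum.inl true ∧
      π κ τ (Sum.inl true) = Sum.inr (Sum.inl none) := by
    intro κ τ
    simp only [π]
    split_ifs <;> simp [Equiv.swap_apply_of_ne_of_ne]
  have hπP : ∀ κ τ, c.1 ≠ 0 → π κ τ (Sum.inr (Sum.inr none)) = Sum.inl false ∧
      π κ τ (Sum.inl false) = Sum.inr (Sum.inr none) := by
    intro κ τ hc
    simp [π, hc, Equiv.swap_apply_of_ne_of_ne]
  have hfL : ∀ κ τ, M'.f κ τ (Sum.inr (Sum.inl none)) = Sum.inl true := by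
    intro κ τ
    refine (congrArg (π κ τ) (Equiv.Perm.viaEmbedding_apply_of_notMem _ _ _ ?_)).trans (hπL κ τ).1
    rintro ⟨z | z | z, hz⟩ <;> simp [Mach.sumEmb] at hz <;> cases hz
  have hfP : ∀ κ τ, c.1 ≠ 0 → M'.f κ τ (Sum.inr (Sum.inr none)) = Sum.inl false := by
    intro κ τ hc
    refine (congrArg (π κ τ) (Equiv.Perm.viaEmbedding_apply_of_notMem _ _ _ ?_)).trans
      (hπP κ τ hc).1
    rintro ⟨z | z | z, hz⟩ <;> simp [Mach.sumEmb] at hz <;> cases hz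
  refine ⟨M', h.extend (fun κ l => rfl) (fun κ τ z => ?_) (fun b v hv => ?_), ?_⟩
  · rcases z with z | z <;> simp only [π] <;> split_ifs <;>
      simp [Mach.sumEmb, Equiv.swap_apply_of_ne_of_ne]
  · cases b with
    | true =>
      refine ⟨true, hatL (rot c) v, hatL_mem _ hv, ?_, hatL_cons_true c v⟩
      rw [(hπL (cl v) (tp v)).2]
      refine Mach.Arr.left (M := M') (cl v) none v _ _ ?_
      rw [hfL (cl v)]
      exact Mach.Arr.halt _ _ _
    | false =>
      by_cases hc : c.1 ≠ 0
      · refine ⟨false, hatA v, hatA_mem hv, ?_, by rw [hatL_cons_false, if_pos hc]⟩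
        rw [(hπP (cl v) (tp v) hc).2]
        refine Mach.Arr.right (M := M') (cl v) none v _ _ ?_
        rw [hfP (!cl v) _ hc]
        exact Mach.Arr.halt _ _ _
      · refine ⟨false, v, hv, ?_, by rw [hatL_cons_false, if_neg hc]⟩
        have : π (cl v) (tp v) (Sum.inl false) = Sum.inl false := by
          simp [π, hc, Equiv.swap_apply_of_ne_of_ne]
        rw [this]
        exact Mach.Arr.halt _ _ _
  · have h1 : ∑ l : Option (M.L true), wtOne η (lab' true l) =
        wtOne η (rot c) + ∑ l, wtOne η (M.lab true l) := Fintype.sum_option _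
    have h2 : ∑ l : Option (M.L false), wtZero η (lab' false l) =
        wtZero η (rot c) + ∑ l, wtZero η (M.lab false l) := Fintype.sum_option _
    have h3 : M'.potential η = ∑ l : Option (M.L true), wtOne η (lab' true l) +
      ∑ l : Option (M.L false), wtZero η (lab' false l) +
        2 * (Fintype.card (Option M.P) : ℝ) := rfl
    rw [h3, h1, h2, Fintype.card_option, Mach.potential, stepCost]
    push_cast
    linarith [wtOne_le hη (rot c), wtZero_le hη (rot c)]

theorem exists_mach_comp {η : ℝ} (hη : 0 < η) (l : List ((ℕ → GA) → ℕ → GA))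
    (hl : ∀ s ∈ l, s ∈ hatGens) :
    ∃ M : Mach Bool, M.Computes cons (comp l) ∧ M.potential η ≤ stepCost η * l.length := by
  induction l with
  | nil =>
    refine ⟨⟨fun _ => Empty, Empty, fun _ => inferInstance, inferInstance, fun _ => Empty.elim,
      fun _ _ => 1⟩, fun b v hv => ⟨b, v, hv, Mach.Arr.halt _ _ _, rfl⟩, ?_⟩
    simp [Mach.potential]
  | cons s l ih =>
    obtain ⟨M, hM, hb⟩ := ih fun t ht => hl t (List.mem_cons_of_mem _ ht)
    have hpos := stepCost_pos hη
    have hletter : ∀ c, s = hatL c → ∃ M : Mach Bool, M.Computes cons (comp (s :: l)) ∧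
        M.potential η ≤ stepCost η * (s :: l).length := by
      rintro c rfl
      obtain ⟨M', hM', hb'⟩ := exists_mach_letter hη hM c
      refine ⟨M', hM', hb'.trans ?_⟩
      rw [List.length_cons]
      push_cast
      linarith
    have hhalts : ∀ σ : Bool → Equiv.Perm Bool, (∀ b v, s (cons b v) = cons (σ (tp v) b) v) →
        ∃ M : Mach Bool, M.Computes cons (comp (s :: l)) ∧
          M.potential η ≤ stepCost η * (s :: l).length := by
      intro σ hσ
      obtain ⟨M', hM', hb'⟩ := exists_mach_halts η hM σ hσ
      refine ⟨M', hM', hb'.le.trans (hb.trans ?_)⟩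
      rw [List.length_cons]
      push_cast
      linarith
    rcases hl s List.mem_cons_self with rfl | rfl | rfl | rfl | rfl
    · refine hhalts (fun τ => if τ then Equiv.boolNot else 1) fun b v => ?_
      rw [hatA0_cons]
      cases tp v <;> simp
    · refine hhalts (fun τ => if τ then 1 else Equiv.boolNot) fun b v => ?_
      rw [hatA1_cons]
      cases tp v <;> simp
    · exact hletter _ hatB_eq
    · exact hletter _ hatC_eq
    · exact hletter _ hatD_eq

/-! ### Merging consecutive letters -/

namespace Mach

variable {I : Type}

/-- The events applying a letter to tails starting with `1` which do not directly follow
another such event. -/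
def Head (M : Mach I) : Type :=
  {l : M.L true // ∀ l', M.f true false (Sum.inr (Sum.inl l')) ≠ Sum.inr (Sum.inl l)}

instance (M : Mach I) : Fintype M.Head := Subtype.fintype _

/-- The inclusion of heads in all events. -/
def headIncl (M : Mach I) : I ⊕ (M.Head ⊕ M.P) → I ⊕ (M.L true ⊕ M.P) :=
  Sum.map id (Sum.map Subtype.val id)

lemma headIncl_injective (M : Mach I) : Function.Injective M.headIncl :=
  Function.injective_id.sumMap (Subtype.val_injective.sumMap Function.injective_id)

/-- The letter applied at an event to tails starting with `1`, and `0` elsewhere. -/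
def letterAt (M : Mach I) : I ⊕ (M.L true ⊕ M.P) → Letter :=
  Sum.elim 0 (Sum.elim (M.lab true) 0)

lemma card_head_le [Fintype I] (M : Mach I) :
    Fintype.card M.Head ≤ Fintype.card I + Fintype.card M.P := by
  have h : ∀ l : M.Head, ∃ z : I ⊕ M.P,
      M.f true false (z.elim Sum.inl (Sum.inr ∘ Sum.inr)) = Sum.inr (Sum.inl l.1) := by
    intro l
    rcases h : (M.f true false).symm (Sum.inr (Sum.inl l.1)) with x | l' | r
    · exact ⟨Sum.inl x, ((Equiv.symm_apply_eq _).1 h).symm⟩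
    · exact absurd ((Equiv.symm_apply_eq _).1 h).symm (l.2 l')
    · exact ⟨Sum.inr r, ((Equiv.symm_apply_eq _).1 h).symm⟩
  choose z hz using h
  rw [← Fintype.card_sum]
  refine Fintype.card_le_of_injective z fun l l' hl => Subtype.ext ?_
  have := hz l
  rw [hl, hz l'] at this
  exact (Sum.inl_injective (Sum.inr_injective this)).symm

/-- The machine in which every maximal run of letters applied to tails starting with `1` is
replaced by one event, given the jumps between these runs and the letters applied after the
first one of each run. -/
def merge (M : Mach I) (r : Equiv.Perm (I ⊕ (M.Head ⊕ M.P))) (s : M.Head → Letter) :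
    Mach I where
  L κ := match κ with
    | true => M.Head
    | false => M.L false
  P := M.P
  finL κ := match κ with
    | true => inferInstanceAs (Fintype M.Head)
    | false => M.finL false
  finP := M.finP
  lab κ := match κ with
    | true => fun l => M.lab true l.1 + s l
    | false => M.lab false
  f κ τ := match κ with
    | true => r
    | false => M.f false τ

/-- The relation between computations before and after merging. -/
def MergeSim (M M' : Mach I) (e : I ⊕ (M.Head ⊕ M.P) → I ⊕ (M'.L true ⊕ M'.P))
    (e' : I ⊕ (M.L false ⊕ M.P) → I ⊕ (M'.L false ⊕ M'.P)) :
    (κ : Bool) → I ⊕ (M.L κ ⊕ M.P) → (ℕ → GA) → I → (ℕ → GA) → Prop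
  | true, z, u, x, u' => ∀ s n,
      Hit (M.f true false) (· ∈ Set.range M.headIncl) M.letterAt z s (M.headIncl n) →
        M'.Arr true (e n) (hatL s u) x u'
  | false, z, u, x, u' => M'.Arr false (e' z) u x u'

lemma Hit.headIncl {M : Mach I} {n n' : I ⊕ (M.Head ⊕ M.P)} {s : Letter}
    (h : Hit (M.f true false) (· ∈ Set.range M.headIncl) M.letterAt (M.headIncl n) s
      (M.headIncl n')) : s = 0 ∧ n' = n := by
  obtain ⟨h1, h2⟩ := h.unique (Hit.here ⟨n, rfl⟩)
  exact ⟨h1, M.headIncl_injective h2⟩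

lemma exists_of_notMem_range_headIncl {M : Mach I} {z : I ⊕ (M.L true ⊕ M.P)}
    (hz : z ∉ Set.range M.headIncl) :
    ∃ l', M.f true false (Sum.inr (Sum.inl l')) = z := by
  rcases z with x | l | q
  · exact absurd ⟨Sum.inl x, rfl⟩ hz
  · by_contra! h
    exact hz ⟨Sum.inr (Sum.inl ⟨l, h⟩), rfl⟩
  · exact absurd ⟨Sum.inr (Sum.inr q), rfl⟩ hz

lemma eq_zero_of_hit {M : Mach I} {n n' : I ⊕ (M.Head ⊕ M.P)} {s : Letter}
    (hn : ∀ l', Sum.inr (Sum.inl l') ≠ M.headIncl n)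
    (h : Hit (M.f true false) (· ∈ Set.range M.headIncl) M.letterAt
      (M.f true false (M.headIncl n)) s (M.headIncl n')) : s = 0 := by
  by_cases hz : M.f true false (M.headIncl n) ∈ Set.range M.headIncl
  · obtain ⟨m, hm⟩ := hz
    rw [← hm] at h
    exact (Hit.headIncl h).1
  · obtain ⟨l', hl'⟩ := exists_of_notMem_range_headIncl hz
    exact absurd ((M.f true false).injective hl') (hn l')

lemma Arr.mergeSim {M : Mach I} {r : Equiv.Perm (I ⊕ (M.Head ⊕ M.P))}
    {s : I ⊕ (M.Head ⊕ M.P) → Letter}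
    (hr : ∀ n, Hit (M.f true false) (· ∈ Set.range M.headIncl) M.letterAt
      (M.f true false (M.headIncl n)) (s n) (M.headIncl (r n)))
    {κ : Bool} {z : I ⊕ (M.L κ ⊕ M.P)} {u : ℕ → GA} {x : I} {u' : ℕ → GA}
    (h : M.Arr κ z u x u') (hu : u ∈ GX) (hκ : cl u = κ) :
    MergeSim M (M.merge r fun l => s (Sum.inr (Sum.inl l))) id id κ z u x u' := by
  induction h with
  | halt κ x u =>
    cases κ with
    | false => exact Arr.halt _ _ _
    | true =>
      intro s' n hn
      obtain ⟨rfl, rfl⟩ := Hit.headIncl (n := Sum.inl x) hn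
      rw [hatL_zero]
      exact Arr.halt _ _ _
  | left κ l u x u' _ ih =>
    have ih := ih (hatL_mem _ hu) (by rw [cl_hatL _ hu, hκ])
    cases κ with
    | false => exact Arr.left (M := M.merge r _) false l u x u' ih
    | true =>
      rw [tp_of_cl (by rw [cl_hatL _ hu, hκ])] at ih
      intro s' n hn
      by_cases hl : ∀ l', M.f true false (Sum.inr (Sum.inl l')) ≠ Sum.inr (Sum.inl l)
      · obtain ⟨rfl, rfl⟩ := Hit.headIncl (n := Sum.inr (Sum.inl ⟨l, hl⟩)) hn
        rw [hatL_zero]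
        refine Arr.left (M := M.merge r fun l => s (Sum.inr (Sum.inl l))) true ⟨l, hl⟩ u x u' ?_
        have := ih _ _ (hr (Sum.inr (Sum.inl ⟨l, hl⟩)))
        rw [← hatL_add _ _ hu] at this
        exact this
      · have hz : (Sum.inr (Sum.inl l) : I ⊕ (M.L true ⊕ M.P)) ∉ Set.range M.headIncl := by
          rintro ⟨z | z | z, hz⟩ <;> cases hz
          exact hl z.2
        generalize hn' : M.headIncl n = y at hn
        cases hn with
        | here h => exact absurd h hz
        | step _ h =>
          subst hn'
          have := ih _ _ h
          rw [← hatL_add _ _ hu] at this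
          exact this
  | right κ q u x u' _ ih =>
    have hcl : cl (hatA u) = !κ := by rw [cl_hatA hu, hκ]
    have ih := ih (hatA_mem hu) hcl
    cases κ with
    | false =>
      rw [tp_of_cl hcl] at ih
      refine Arr.right (M := M.merge r _) false q u x u' ?_
      have h0 := eq_zero_of_hit (n := Sum.inr (Sum.inr q)) (fun l' h => by cases h)
        (hr (Sum.inr (Sum.inr q)))
      have := ih _ _ (hr (Sum.inr (Sum.inr q)))
      rw [h0, hatL_zero] at this
      exact this
    | true =>
      intro s' n hn
      obtain ⟨rfl, rfl⟩ := Hit.headIncl (n := Sum.inr (Sum.inr q)) hn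
      rw [hatL_zero]
      exact Arr.right (M := M.merge r _) true q u x u' ih

theorem exists_merge {η : ℝ} (hη : 0 < η) [Fintype I] {M : Mach I}
    {ins : I → (ℕ → GA) → ℕ → GA} {g : (ℕ → GA) → ℕ → GA} (h : M.Computes ins g) :
    ∃ M' : Mach I, M'.Computes ins g ∧ M'.potential η ≤ M.potential η ∧
      Fintype.card (M'.L true) ≤ Fintype.card I + Fintype.card M'.P := by
  obtain ⟨r, s, hr, hs⟩ :=
    exists_return_of_injective (M.f true false) M.headIncl_injective M.letterAt
  refine ⟨M.merge r fun l => s (Sum.inr (Sum.inl l)), fun x u hu => ?_, ?_, M.card_head_le⟩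
  · obtain ⟨x', u', hu', hA, hg⟩ := h x u hu
    refine ⟨x', u', hu', ?_, hg⟩
    have hsim := hA.mergeSim hr hu rfl
    cases hκ : cl u with
    | false =>
      rw [hκ] at hsim
      exact hsim
    | true =>
      rw [hκ, tp_of_cl hκ] at hsim
      have h0 := eq_zero_of_hit (n := Sum.inl x) (fun l' h => by cases h) (hr (Sum.inl x))
      have := hsim _ _ (hr (Sum.inl x))
      rw [h0, hatL_zero] at this
      exact this
  · have h1 := hs (wtOne η) (wtOne_nonneg hη) (wtOne_add_le hη)
    rw [Fintype.sum_sum_type, Fintype.sum_sum_type, Fintype.sum_sum_type,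
      Fintype.sum_sum_type] at h1
    have h2 : ∀ z, 0 ≤ wtOne η z := wtOne_nonneg hη
    change ∑ x, wtOne η (0 + s (Sum.inl x)) +
        (∑ l : M.Head, wtOne η (M.lab true l.1 + s (Sum.inr (Sum.inl l))) +
          ∑ q, wtOne η (0 + s (Sum.inr (Sum.inr q)))) ≤
      ∑ x : I, wtOne η 0 + (∑ l, wtOne η (M.lab true l) + ∑ q : M.P, wtOne η 0) at h1
    simp only [wtOne_zero, Finset.sum_const_zero, zero_add, add_zero] at h1
    have h3 := Finset.sum_nonneg fun (x : I) (_ : x ∈ Finset.univ) => h2 (s (Sum.inl x))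
    have h4 := Finset.sum_nonneg fun (q : M.P) (_ : q ∈ Finset.univ) =>
      h2 (s (Sum.inr (Sum.inr q)))
    have h5 : (M.merge r fun l => s (Sum.inr (Sum.inl l))).potential η =
      ∑ l : M.Head, wtOne η (M.lab true l.1 + s (Sum.inr (Sum.inl l))) +
        ∑ l, wtZero η (M.lab false l) + 2 * (Fintype.card M.P : ℝ) := rfl
    rw [h5, potential]
    linarith

end Mach

/-! ### Reading one more letter -/

namespace Mach

variable {I : Type}

/-- The halts and events for both classes together. -/
abbrev Joint (M : Mach I) : Type := (I ⊕ (M.L true ⊕ M.P)) ⊕ (I ⊕ (M.L false ⊕ M.P))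

/-- The inclusion of the halts and events of one class. -/
def toJoint (M : Mach I) : (κ : Bool) → I ⊕ (M.L κ ⊕ M.P) → M.Joint
  | true => Sum.inl
  | false => Sum.inr

/-- Exchange the two copies of the events applying `a`. -/
def swapFun (M : Mach I) : M.Joint → M.Joint
  | Sum.inl (Sum.inr (Sum.inr q)) => Sum.inr (Sum.inr (Sum.inr q))
  | Sum.inr (Sum.inr (Sum.inr q)) => Sum.inl (Sum.inr (Sum.inr q))
  | z => z

lemma swapFun_involutive (M : Mach I) : Function.Involutive M.swapFun := by
  rintro ((x | l | q) | (x | l | q)) <;> rfl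

/-- The jumps for sequences `cons κ v`, where `τ` is the type of `v`. -/
def jump (M : Mach I) (τ : Bool) : Equiv.Perm M.Joint :=
  M.swapFun_involutive.toPerm.trans (Equiv.sumCongr (M.f true false) (M.f false (!τ)))

lemma jump_halt (M : Mach I) (κ : Bool) (v : ℕ → GA) (x : I) :
    M.jump (tp v) (M.toJoint κ (Sum.inl x)) =
      M.toJoint κ (M.f κ (tp (cons κ v)) (Sum.inl x)) := by
  cases κ <;> simp <;> rfl

lemma jump_left (M : Mach I) (κ : Bool) (v : ℕ → GA) (l : M.L κ) :
    M.jump (tp v) (M.toJoint κ (Sum.inr (Sum.inl l))) =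
      M.toJoint κ (M.f κ (tp (cons κ v)) (Sum.inr (Sum.inl l))) := by
  cases κ <;> simp <;> rfl

lemma jump_right (M : Mach I) (κ : Bool) (v : ℕ → GA) (q : M.P) :
    M.jump (tp v) (M.toJoint κ (Sum.inr (Sum.inr q))) =
      M.toJoint (!κ) (M.f (!κ) (tp (cons (!κ) v)) (Sum.inr (Sum.inr q))) := by
  cases κ <;> simp <;> rfl

/-- The events whose letter applies `a` after a first letter `0₀` or `0₁`. -/
def Second (M : Mach I) : Type := {l : M.L false // (M.lab false l).1 ≠ 0}

instance (M : Mach I) : Fintype M.Second := Subtype.fintype _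

/-- The inclusion of the halts and events relevant after reading one more letter. -/
def upIncl (M : Mach I) : I × Bool ⊕ (M.L true ⊕ M.Second) → M.Joint
  | Sum.inl (x, κ) => M.toJoint κ (Sum.inl x)
  | Sum.inr (Sum.inl l) => Sum.inl (Sum.inr (Sum.inl l))
  | Sum.inr (Sum.inr l) => Sum.inr (Sum.inr (Sum.inl l.1))

lemma upIncl_injective (M : Mach I) : Function.Injective M.upIncl := by
  rintro (⟨x, _ | _⟩ | l | l) (⟨x', _ | _⟩ | l' | l') h
  all_goals first
    | (cases h; rfl)
    | cases h
    | exact congrArg (Sum.inr ∘ Sum.inr)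
        (Subtype.ext (Sum.inl_injective (Sum.inr_injective (Sum.inr_injective h))))

/-- The machine obtained by reading one more letter, given the jumps between relevant
halts and events. -/
def up (M : Mach I) (r : Bool → Equiv.Perm (I × Bool ⊕ (M.L true ⊕ M.Second))) :
    Mach (I × Bool) where
  L _ := M.L true
  P := M.Second
  finL _ := M.finL true
  finP := inferInstance
  lab _ l := rot (M.lab true l)
  f _ τ := r τ

lemma Arr.up {M : Mach I} {r : Bool → Equiv.Perm (I × Bool ⊕ (M.L true ⊕ M.Second))}
    {s : Bool → I × Bool ⊕ (M.L true ⊕ M.Second) → Letter}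
    (hr : ∀ τ n, Hit (M.jump τ) (· ∈ Set.range M.upIncl) 0
      (M.jump τ (M.upIncl n)) (s τ n) (M.upIncl (r τ n)))
    {κ : Bool} {z : I ⊕ (M.L κ ⊕ M.P)} {u : ℕ → GA} {x : I} {u' : ℕ → GA}
    (h : M.Arr κ z u x u') {v : ℕ → GA} (hv : v ∈ GX) (hu : u = cons κ v) {t : Letter}
    {n : I × Bool ⊕ (M.L true ⊕ M.Second)}
    (hn : Hit (M.jump (tp v)) (· ∈ Set.range M.upIncl) 0 (M.toJoint κ z) t (M.upIncl n)) :
    ∃ κ', ∃ v' ∈ GX, u' = cons κ' v' ∧ (M.up r).Arr (cl v) n v (x, κ') v' := by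
  have hrange : ∀ {n n' : I × Bool ⊕ (M.L true ⊕ M.Second)} {τ : Bool} {t : Letter},
      Hit (M.jump τ) (· ∈ Set.range M.upIncl) 0 (M.upIncl n) t (M.upIncl n') → n' = n :=
    fun h => M.upIncl_injective
      (h.unique (Hit.here (wt := (0 : M.Joint → Letter)) ⟨_, rfl⟩)).2
  have hstep : ∀ {z : M.Joint} {n : I × Bool ⊕ (M.L true ⊕ M.Second)} {τ : Bool} {t : Letter},
      z ∉ Set.range M.upIncl → Hit (M.jump τ) (· ∈ Set.range M.upIncl) 0 z t (M.upIncl n) →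
        ∃ t' : Letter, Hit (M.jump τ) (· ∈ Set.range M.upIncl) 0 (M.jump τ z) t' (M.upIncl n) := by
    intro z n τ t hz h
    generalize M.upIncl n = y at h
    cases h with
    | here h => exact absurd h hz
    | step _ h => exact ⟨_, h⟩
  induction h generalizing v t n with
  | halt κ x u =>
    obtain rfl := hrange (n := Sum.inl (x, κ)) hn
    exact ⟨κ, v, hv, hu, Arr.halt _ _ _⟩
  | left κ l u x u' _ ih =>
    subst hu
    cases κ with
    | true =>
      obtain rfl := hrange (n := Sum.inr (Sum.inl l)) hn
      rw [hatL_cons_true] at ih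
      have hj := hr (tp (hatL (rot (M.lab true l)) v)) (Sum.inr (Sum.inl l))
      change Hit _ _ _ (M.jump _ (M.toJoint true (Sum.inr (Sum.inl l)))) _ _ at hj
      rw [jump_left] at hj
      obtain ⟨κ', v', hv', hu', hA⟩ := ih (hatL_mem _ hv) rfl hj
      rw [cl_hatL _ hv] at hA
      exact ⟨κ', v', hv', hu', Arr.left (M := M.up r) (cl v) l v _ _ hA⟩
    | false =>
      by_cases hl : (M.lab false l).1 ≠ 0
      · obtain rfl := hrange (n := Sum.inr (Sum.inr ⟨l, hl⟩)) hn
        rw [hatL_cons_false, if_pos hl] at ih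
        have hj := hr (tp (hatA v)) (Sum.inr (Sum.inr ⟨l, hl⟩))
        change Hit _ _ _ (M.jump _ (M.toJoint false (Sum.inr (Sum.inl l)))) _ _ at hj
        rw [jump_left] at hj
        obtain ⟨κ', v', hv', hu', hA⟩ := ih (hatA_mem hv) rfl hj
        rw [cl_hatA hv] at hA
        exact ⟨κ', v', hv', hu', Arr.right (M := M.up r) (cl v) ⟨l, hl⟩ v _ _ hA⟩
      · have hz : M.toJoint false (Sum.inr (Sum.inl l)) ∉ Set.range M.upIncl := by
          rintro ⟨⟨x, _ | _⟩ | z | z, hz⟩ <;> cases hz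
          exact hl z.2
        rw [hatL_cons_false, if_neg hl] at ih
        obtain ⟨t', h⟩ := hstep hz hn
        rw [jump_left] at h
        exact ih hv rfl h
  | right κ q u x u' _ ih =>
    subst hu
    have hz : M.toJoint κ (Sum.inr (Sum.inr q)) ∉ Set.range M.upIncl := by
      rintro ⟨⟨x, _ | _⟩ | z | z, hz⟩ <;> cases κ <;> cases hz
    rw [hatA_cons] at ih
    obtain ⟨t', h⟩ := hstep hz hn
    rw [jump_right] at h
    exact ih hv rfl h

theorem exists_up [Fintype I] {M : Mach I} {ins : I → (ℕ → GA) → ℕ → GA}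
    {g : (ℕ → GA) → ℕ → GA} (h : M.Computes ins g) :
    ∃ r, (M.up r).Computes (fun x v => ins x.1 (cons x.2 v)) g := by
  choose r s hr using fun τ =>
    exists_return_of_injective (M.jump τ) M.upIncl_injective (0 : M.Joint → Letter)
  refine ⟨r, ?_⟩
  rintro ⟨x, κ⟩ v hv
  obtain ⟨x', u', hu', hA, hg⟩ := h x (cons κ v) (cons_mem hv κ)
  rw [cl_cons] at hA
  have hj := (hr (tp v)).1 (Sum.inl (x, κ))
  change Hit _ _ _ (M.jump _ (M.toJoint κ (Sum.inl x))) _ _ at hj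
  rw [jump_halt] at hj
  obtain ⟨κ', v', hv', rfl, hA'⟩ := hA.up (fun τ => (hr τ).1) hv rfl hj
  exact ⟨(x', κ'), v', hv', hA', hg⟩

lemma card_second (η : ℝ) (M : Mach I) :
    ∑ l, wtZero η (M.lab false l) = 2 / η * Fintype.card M.Second := by
  simp only [wtZero, ← Finset.mul_sum, ind]
  congr 1
  have : Fintype.card M.Second =
      (Finset.univ.filter fun l => (M.lab false l).1 ≠ 0).card := Fintype.card_subtype _
  rw [this, Finset.card_filter]
  push_cast
  refine Finset.sum_congr rfl fun l _ => ?_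
  split_ifs <;> simp_all

lemma wtOne_rot_add_wtZero_rot {η : ℝ} (hη : 0 < η) (hroot : η ^ 4 + η ^ 3 + η ^ 2 = 2)
    (c : Letter) :
    wtOne η (rot c) + wtZero η (rot c) ≤ η * (2 + wtOne η c) := by
  have h2 : 2 / η = η ^ 3 + η ^ 2 + η := by
    field_simp
    linarith
  have h3 : ∀ p q : ZMod 2, q + (p + q) = p := by decide
  have h5 : (1 + 1 : ZMod 2) = 0 := by decide
  have h4 : ∀ p : ZMod 2, p = 0 ∨ p = 1 := by decide
  obtain ⟨p, q⟩ := c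
  unfold wtOne wtZero rot
  simp only [h2, h3]
  rcases h4 p with rfl | rfl <;> rcases h4 q with rfl | rfl <;>
    simp [ind, h5] <;> nlinarith

theorem exists_next {η : ℝ} (hη : 0 < η) (hroot : η ^ 4 + η ^ 3 + η ^ 2 = 2) [Fintype I]
    {M : Mach I} {ins : I → (ℕ → GA) → ℕ → GA} {g : (ℕ → GA) → ℕ → GA}
    (h : M.Computes ins g) :
    ∃ M' : Mach (I × Bool), M'.Computes (fun x v => ins x.1 (cons x.2 v)) g ∧
      M'.potential η ≤ η * (M.potential η + 2 * Fintype.card I) ∧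
      ∀ κ, 2 * (Fintype.card (M'.L κ) : ℝ) ≤ M.potential η + 2 * Fintype.card I := by
  obtain ⟨N, hN, hpot, hcard⟩ := exists_merge hη h
  obtain ⟨r, hr⟩ := exists_up hN
  have hcard' : (Fintype.card (N.L true) : ℝ) ≤ Fintype.card I + Fintype.card N.P := by
    exact_mod_cast hcard
  refine ⟨N.up r, hr, ?_, fun κ => ?_⟩
  · have h1 : (N.up r).potential η = ∑ l, wtOne η (rot (N.lab true l)) +
      ∑ l, wtZero η (rot (N.lab true l)) + 2 * (Fintype.card N.Second : ℝ) := rfl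
    have h2 := Finset.sum_le_sum fun l (_ : l ∈ Finset.univ) =>
      wtOne_rot_add_wtZero_rot hη hroot (N.lab true l)
    rw [Finset.sum_add_distrib, ← Finset.mul_sum, Finset.sum_add_distrib, Finset.sum_const,
      Finset.card_univ, nsmul_eq_mul] at h2
    have h3 : 2 * (Fintype.card N.Second : ℝ) = η * ∑ l, wtZero η (N.lab false l) := by
      rw [card_second]
      field_simp
    rw [h1, h3]
    refine (add_le_add_left h2 _).trans ?_
    rw [← mul_add]
    refine mul_le_mul_of_nonneg_left ?_ hη.le
    unfold potential at hpot ⊢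
    linarith
  · have h1 := N.two_mul_card_le_potential hη
    change 2 * (Fintype.card (N.L true) : ℝ) ≤ _
    linarith

end Mach

/-! ### Longer initial segments -/

/-- The type recording the classes of the first `n + 1` tails of a sequence. -/
def Prefix : ℕ → Type
  | 0 => Bool
  | n + 1 => Prefix n × Bool

instance instFintypePrefix : ∀ n, Fintype (Prefix n)
  | 0 => inferInstanceAs (Fintype Bool)
  | n + 1 =>
    letI := instFintypePrefix n
    inferInstanceAs (Fintype (Prefix n × Bool))

lemma card_prefixType (n : ℕ) : Fintype.card (Prefix n) = 2 ^ (n + 1) := by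
  induction n with
  | zero => rfl
  | succ n ih =>
    have : Fintype.card (Prefix (n + 1)) = Fintype.card (Prefix n × Bool) := rfl
    rw [this, Fintype.card_prod, ih, Fintype.card_bool, pow_succ _ (n + 1)]

/-- The sequence with the given initial segment and tail. -/
def insertPrefix : ∀ n, Prefix n → (ℕ → GA) → ℕ → GA
  | 0 => cons
  | n + 1 => fun x v => insertPrefix n x.1 (cons x.2 v)

lemma exists_insertPrefix (n : ℕ) {w : ℕ → GA} (hw : w ∈ GX) :
    ∃ x, ∃ u ∈ GX, insertPrefix n x u = w := by
  induction n with
  | zero =>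
    obtain ⟨b, v, hv, rfl⟩ := exists_cons hw
    exact ⟨b, v, hv, rfl⟩
  | succ n ih =>
    obtain ⟨x, u, hu, rfl⟩ := ih
    obtain ⟨b, v, hv, rfl⟩ := exists_cons hu
    exact ⟨(x, b), v, hv, rfl⟩

lemma lt_one_of_root {η : ℝ} (hroot : η ^ 4 + η ^ 3 + η ^ 2 = 2) : η < 1 := by
  by_contra! h
  linarith [one_le_pow₀ h (n := 4), one_le_pow₀ h (n := 3), one_le_pow₀ h (n := 2)]

theorem exists_mach_level {η : ℝ} (hη : 0 < η) (hroot : η ^ 4 + η ^ 3 + η ^ 2 = 2) {R : ℕ}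
    {l : List ((ℕ → GA) → ℕ → GA)} (hl : ∀ s ∈ l, s ∈ hatGens) (hR : l.length ≤ R) (n : ℕ) :
    ∃ M : Mach (Prefix n), M.Computes (insertPrefix n) (comp l) ∧
      M.potential η ≤ stepCost η * (η ^ n * R) + 4 * 2 ^ n := by
  induction n with
  | zero =>
    obtain ⟨M, hM, hpot⟩ := exists_mach_comp hη l hl
    refine ⟨M, hM, hpot.trans ?_⟩
    have : (l.length : ℝ) ≤ R := by exact_mod_cast hR
    have := mul_le_mul_of_nonneg_left this (stepCost_pos hη).le
    rw [pow_zero, pow_zero, one_mul]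
    linarith
  | succ n ih =>
    obtain ⟨M, hM, hpot⟩ := ih
    obtain ⟨M', hM', hpot', -⟩ := Mach.exists_next hη hroot hM
    refine ⟨M', hM', hpot'.trans ?_⟩
    rw [card_prefixType]
    push_cast
    calc η * (M.potential η + 2 * 2 ^ (n + 1))
        ≤ η * ((stepCost η * (η ^ n * R) + 4 * 2 ^ n) + 2 * 2 ^ (n + 1)) := by gcongr
      _ = stepCost η * (η ^ (n + 1) * R) + η * (4 * 2 ^ (n + 1)) := by ring
      _ ≤ stepCost η * (η ^ (n + 1) * R) + 1 * (4 * 2 ^ (n + 1)) := by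
          gcongr
          exact (lt_one_of_root hroot).le
      _ = _ := by ring

/-! ### Counting machines -/

/-- The data of a machine with `B` events of each kind. -/
abbrev Code (I : Type) (B : ℕ) : Type :=
  (Bool → Fin B → Letter) × (Bool → Bool → Equiv.Perm (I ⊕ (Fin B ⊕ Fin B)))

/-- The machine with the given data. -/
def Code.mach {I : Type} {B : ℕ} (c : Code I B) : Mach I where
  L _ := Fin B
  P := Fin B
  finL _ := inferInstance
  finP := inferInstance
  lab := c.1
  f := c.2

lemma Mach.exists_code {I : Type} {B : ℕ} {M : Mach I} {ins : I → (ℕ → GA) → ℕ → GA}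
    {g : (ℕ → GA) → ℕ → GA} (h : M.Computes ins g) (hL : ∀ κ, Fintype.card (M.L κ) ≤ B)
    (hP : Fintype.card M.P ≤ B) : ∃ c : Code I B, c.mach.Computes ins g := by
  have hL' : ∀ κ, Nonempty (M.L κ ↪ Fin B) := fun κ =>
    Function.Embedding.nonempty_of_card_le (by simpa using hL κ)
  obtain ⟨iP⟩ : Nonempty (M.P ↪ Fin B) :=
    Function.Embedding.nonempty_of_card_le (by simpa using hP)
  let iL : ∀ κ, M.L κ ↪ Fin B := fun κ => (hL' κ).some
  let M' := M.extend (L' := fun _ => Fin B) iL iP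
    (fun κ => Function.extend (iL κ) (M.lab κ) 0) fun _ _ => 1
  refine ⟨(M'.lab, M'.f), ?_⟩
  exact h.extend (g' := id) (fun κ l => (iL κ).injective.extend_apply _ _ _)
    (fun _ _ _ => rfl) fun x u hu => ⟨x, u, hu, Mach.Arr.halt _ _ _, rfl⟩

lemma card_code (I : Type) [Fintype I] (B : ℕ) :
    Nat.card (Code I B) = (4 ^ B) ^ 2 * ((Fintype.card I + 2 * B).factorial ^ 2) ^ 2 := by
  have h : Nat.card (I ⊕ (Fin B ⊕ Fin B)) = Fintype.card I + 2 * B := by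
    simp [two_mul]
  have h2 : Nat.card Letter = 4 := by simp [Letter]
  rw [Nat.card_prod, Nat.card_fun, Nat.card_fun, Nat.card_fun, Nat.card_fun, Nat.card_perm, h, h2]
  simp

lemma card_code_le (I : Type) [Fintype I] (B : ℕ) (hI : 4 ≤ Fintype.card I) :
    Nat.card (Code I B) ≤ (Fintype.card I + 2 * B) ^ (5 * (Fintype.card I + 2 * B)) := by
  rw [card_code]
  set m := Fintype.card I + 2 * B
  have h1 : (4 ^ B) ^ 2 ≤ m ^ m := calc
    (4 ^ B) ^ 2 = 4 ^ (2 * B) := by rw [← pow_mul, mul_comm]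
    _ ≤ m ^ (2 * B) := Nat.pow_le_pow_left (by omega) _
    _ ≤ m ^ m := Nat.pow_le_pow_right (by omega) (by omega)
  have h2 : (m.factorial ^ 2) ^ 2 ≤ m ^ (4 * m) := calc
    (m.factorial ^ 2) ^ 2 = m.factorial ^ 4 := by rw [← pow_mul]
    _ ≤ (m ^ m) ^ 4 := Nat.pow_le_pow_left (Nat.factorial_le_pow m) _
    _ = m ^ (4 * m) := by rw [← pow_mul, mul_comm]
  calc _ ≤ m ^ m * m ^ (4 * m) := Nat.mul_le_mul h1 h2
    _ = m ^ (5 * m) := by rw [← pow_add]; congr 1; ring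

lemma hatGrowth_le_card_code {n B R : ℕ}
    (h : ∀ l : List ((ℕ → GA) → ℕ → GA), (∀ s ∈ l, s ∈ hatGens) → l.length ≤ R →
      ∃ c : Code (Prefix n) B, c.mach.Computes (insertPrefix n) (comp l)) :
    hatGrowth R ≤ Nat.card (Code (Prefix n) B) := by
  have h' : ∀ t : ((fun f : (ℕ → GA) → ℕ → GA => GX.restrict f) ''
      {f | ∃ l : List ((ℕ → GA) → ℕ → GA),
        (∀ s ∈ l, s ∈ hatGens) ∧ l.length ≤ R ∧ comp l = f}),
      ∃ c : Code (Prefix n) B, ∃ g, c.mach.Computes (insertPrefix n) g ∧ GX.restrict g = t := by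
    rintro ⟨_, _, ⟨l, hl, hR, rfl⟩, rfl⟩
    obtain ⟨c, hc⟩ := h l hl hR
    exact ⟨c, _, hc, rfl⟩
  choose c g hg ht using h'
  refine Nat.card_le_card_of_injective c fun t t' htt => Subtype.ext ?_
  rw [← ht, ← ht]
  funext w
  obtain ⟨x, u, hu, hw⟩ := exists_insertPrefix n w.2
  have h1 := hg t
  rw [htt] at h1
  have := h1.eq_of_computes (hg t') hu (x := x)
  rw [hw] at this
  exact this

theorem hatGrowth_le {η : ℝ} (hη : 0 < η) (hroot : η ^ 4 + η ^ 3 + η ^ 2 = 2) (n R : ℕ) :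
    ∃ m : ℕ, 1 ≤ m ∧ (m : ℝ) ≤ 2 * stepCost η * (η ^ n * R) + 12 * 2 ^ n ∧
      hatGrowth R ≤ m ^ (5 * m) := by
  set D : ℝ := stepCost η * (η ^ n * R) + 4 * 2 ^ n with hD
  have hcost := stepCost_pos hη
  have hD1 : 4 * 2 ^ n ≤ D := by
    rw [hD]
    have : 0 ≤ stepCost η * (η ^ n * R) := by positivity
    linarith
  have hD0 : 0 ≤ D := le_trans (by positivity) hD1
  have h4 : 4 ≤ Fintype.card (Prefix (n + 1)) := by
    rw [card_prefixType, pow_succ, pow_succ]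
    have := Nat.one_le_two_pow (n := n)
    omega
  refine ⟨Fintype.card (Prefix (n + 1)) + 2 * ⌊D⌋₊, by omega, ?_,
    (hatGrowth_le_card_code (n := n + 1) fun l hl hR => ?_).trans (card_code_le _ _ h4)⟩
  · rw [card_prefixType]
    push_cast
    have := Nat.floor_le hD0
    have h2 : (2 : ℝ) ^ (n + 1 + 1) = 4 * 2 ^ n := by ring
    rw [h2]
    linarith
  · obtain ⟨M, hM, hpot⟩ := exists_mach_level hη hroot hl hR n
    obtain ⟨M', hM', hpot', hL⟩ := Mach.exists_next hη hroot hM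
    have hcard : (Fintype.card (Prefix n) : ℝ) = 2 * 2 ^ n := by
      rw [card_prefixType]
      push_cast
      ring
    rw [hcard] at hpot' hL
    refine Mach.exists_code (M := M') hM' (fun κ => Nat.le_floor ?_) (Nat.le_floor ?_)
    · linarith [hL κ]
    · have h1 := M'.two_mul_card_le_potential hη
      have h0 : 0 ≤ M.potential η + 2 * (2 * 2 ^ n) := by
        have hP := M.two_mul_card_le_potential hη
        have hc : (0 : ℝ) ≤ Fintype.card M.P := Nat.cast_nonneg _
        have hp : (0 : ℝ) ≤ 2 ^ n := by positivity
        linarith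
      have h2 : η * (M.potential η + 2 * (2 * 2 ^ n)) ≤ 1 * (D + D) :=
        mul_le_mul (lt_one_of_root hroot).le (by linarith) h0 zero_le_one
      linarith

/-- `m ^ (5 m)` is stretched-exponential in any quantity that dominates `m` polynomially. -/
theorem cast_pow_self_le_exp {m : ℕ} (hm : 1 ≤ m) {A β δ x : ℝ} (hA : 0 ≤ A) (hx : 0 ≤ x)
    (hδ : 0 < δ) (hmx : (m : ℝ) ≤ A * x ^ β) :
    ((m ^ (5 * m) : ℕ) : ℝ) ≤ Real.exp (5 / δ * A ^ (1 + δ) * x ^ (β * (1 + δ))) := by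
  have hm0 : (0 : ℝ) < m := by exact_mod_cast hm
  have hlog := Real.log_le_rpow_div hm0.le hδ
  push_cast
  rw [← Real.exp_log (pow_pos hm0 (5 * m)), Real.log_pow, Real.exp_le_exp]
  push_cast
  calc 5 * (m : ℝ) * Real.log m ≤ 5 * (m : ℝ) * ((m : ℝ) ^ δ / δ) := by gcongr
    _ = 5 / δ * (m : ℝ) ^ (1 + δ) := by
        rw [Real.rpow_add hm0, Real.rpow_one]
        ring
    _ ≤ 5 / δ * (A * x ^ β) ^ (1 + δ) := by gcongr
    _ = 5 / δ * A ^ (1 + δ) * x ^ (β * (1 + δ)) := by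
        rw [Real.mul_rpow hA (Real.rpow_nonneg hx _), ← Real.rpow_mul hx]
        ring

theorem hatGrowth_le_exp {η : ℝ} (hη : 0 < η) (hroot : η ^ 4 + η ^ 3 + η ^ 2 = 2)
    {δ : ℝ} (hδ : 0 < δ) {R : ℕ} (hR : 1 ≤ R) :
    (hatGrowth R : ℝ) ≤ Real.exp (5 / δ * (4 * stepCost η / η + 12) ^ (1 + δ) *
      (R : ℝ) ^ (Real.log 2 / (Real.log 2 - Real.log η) * (1 + δ))) := by
  have hη1 := lt_one_of_root hroot
  have hK := stepCost_pos hη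
  have hR' : (1 : ℝ) ≤ R := by exact_mod_cast hR
  have hq : 1 < 2 / η := by
    rw [lt_div_iff₀ hη]
    linarith
  have hlog2 : 0 < Real.log 2 := Real.log_pos one_lt_two
  have hlogη : Real.log η < 0 := Real.log_neg hη hη1
  set β := Real.log 2 / (Real.log 2 - Real.log η) with hβ
  have hβ0 : 0 < β := div_pos hlog2 (by linarith)
  have hqβ : (2 / η) ^ β = 2 := by
    rw [Real.rpow_def_of_pos (by positivity), Real.log_div two_ne_zero hη.ne', hβ,
      mul_div_cancel₀ _ (by linarith), Real.exp_log two_pos]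
  obtain ⟨n, hn, hn'⟩ := exists_nat_pow_near hR' hq
  have h2n : (2 : ℝ) ^ n ≤ (R : ℝ) ^ β := by
    calc (2 : ℝ) ^ n = ((2 / η) ^ n) ^ β := by
          rw [← Real.rpow_natCast (2 / η), ← Real.rpow_mul (by positivity), mul_comm,
            Real.rpow_mul (by positivity), hqβ, Real.rpow_natCast]
      _ ≤ (R : ℝ) ^ β := by gcongr
  obtain ⟨m, hm, hmle, hgrowth⟩ := hatGrowth_le hη hroot n R
  have hηR : η ^ n * R ≤ 2 / η * 2 ^ n := by
    calc η ^ n * R ≤ η ^ n * (2 / η) ^ (n + 1) := by gcongr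
      _ = 2 / η * 2 ^ n := by
        rw [pow_succ, div_pow]
        field_simp
  have hmx : (m : ℝ) ≤ (4 * stepCost η / η + 12) * (R : ℝ) ^ β := by
    calc (m : ℝ) ≤ 2 * stepCost η * (η ^ n * R) + 12 * 2 ^ n := hmle
      _ ≤ 2 * stepCost η * (2 / η * 2 ^ n) + 12 * 2 ^ n := by gcongr
      _ = (4 * stepCost η / η + 12) * 2 ^ n := by ring
      _ ≤ _ := by gcongr
  exact (Nat.cast_le.mpr hgrowth).trans
    (cast_pow_self_le_exp hm (by positivity) (by positivity) hδ hmx)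

/-- Let `Ĝ = ⟨a₀, a₁, b, c, d⟩` be the virtually simple torsion
group containing the first Grigorchuk group, acting on the space `X` of sequences
over `{0₀, 0₁, 1}` with allowed two-letter subwords
`{0₀0₁, 0₁0₀, 0₁1, 10₀, 10₁, 11}`, and let `η ≈ 0.87176` be the positive root of
`x⁴ + x³ + x² − 2`. Then for every `α > log 2/(log 2 − log η) ≈ 0.83473` the
growth of `Ĝ` satisfies `γ_Ĝ(R) ≼ exp(R^α)`. -/
theorem simpleGrig_growth_upper_bound
    (η : ℝ) (hη : 0 < η) (hroot : η ^ 4 + η ^ 3 + η ^ 2 = 2) :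
    ∀ α : ℝ, Real.log 2 / (Real.log 2 - Real.log η) < α →
      ∃ C : ℝ, 1 ≤ C ∧ ∀ R : ℕ, 1 ≤ R →
        (hatGrowth R : ℝ) ≤ Real.exp ((C * (R : ℝ)) ^ α) := by
  intro α hα
  set β := Real.log 2 / (Real.log 2 - Real.log η) with hβ
  have hβ0 : 0 < β := div_pos (Real.log_pos one_lt_two) <| by
    linarith [Real.log_pos one_lt_two, Real.log_neg hη (lt_one_of_root hroot)]
  have hα0 : 0 < α := hβ0.trans hα
  have hδ : 0 < α / β - 1 := by
    rw [sub_pos, lt_div_iff₀ hβ0]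
    linarith
  have hexp : β * (1 + (α / β - 1)) = α := by
    field_simp
    ring
  have hK := stepCost_pos hη
  set B : ℝ := 5 / (α / β - 1) * (4 * stepCost η / η + 12) ^ (1 + (α / β - 1)) with hB
  have hB0 : 0 ≤ B := by positivity
  refine ⟨max 1 (B ^ α⁻¹), le_max_left _ _, fun R hR => ?_⟩
  refine (hatGrowth_le_exp hη hroot hδ hR).trans (Real.exp_le_exp.mpr ?_)
  rw [← hβ, hexp, ← hB, Real.mul_rpow (by positivity) (by positivity)]
  gcongr
  calc B = (B ^ α⁻¹) ^ α := (Real.rpow_inv_rpow hB0 hα0.ne').symm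
    _ ≤ _ := by
      gcongr
      exact le_max_right _ _

end SimpleGrig
end
end
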